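/- arXiv:1901.00325 — 10 statements merged into one kernel-verified Lean document; each statement's English description precedes it below -/
import Mathlib

section
/- For every integer r ≥ 1 and every real number λ ≥ 14, there exists a map f : [0,4] → [0,4] of class C^r which is topologically mixing and satisfies sup_{x ∈ [0,4]} |f'(x)| = λ^r. -/
open Set

/-- `f` is topologically mixing on the invariant set `I`
(openness is relative to the subspace topology on `I`). -/
def IsTopologicallyMixingOn (f : ℝ → ℝ) (I : Set ℝ) : Prop :=
  ∀ U V : Set ℝ, U ⊆ I → V ⊆ I →
    (∃ U' : Set ℝ, IsOpen U' ∧ U = U' ∩ I) →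
    (∃ V' : Set ℝ, IsOpen V' ∧ V = V' ∩ I) →
    U.Nonempty → V.Nonempty →
    ∃ N : ℕ, ∀ n ≥ N, (f^[n] ⁻¹' U ∩ V).Nonempty

/-- Denominator of the map. -/
noncomputable def denE (q x : ℝ) : ℝ := 4 * x * (4 - x) + (4 - (1 + q) * x) ^ 2

/-- A Moebius conjugate of the quadratic Chebyshev map. -/
noncomputable def mapF (q x : ℝ) : ℝ := 16 * x * (4 - x) / denE q x

/-- The Moebius conjugacy from `[-1,1]` to `[0,4]`. -/
noncomputable def phi (q c : ℝ) : ℝ := 4 * (1 - c) / ((1 - c) + q * (1 + c))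

lemma phi_den_pos {q c : ℝ} (hq : 0 < q) (h1 : -1 ≤ c) (h2 : c ≤ 1) :
    0 < (1 - c) + q * (1 + c) := by
  rcases h2.lt_or_eq with h | h
  · have : 0 ≤ q * (1 + c) := mul_nonneg hq.le (by linarith)
    linarith
  · subst h; linarith

lemma denE_pos {q x : ℝ} (hq : 0 < q) (h0 : 0 ≤ x) (h4 : x ≤ 4) : 0 < denE q x := by
  unfold denE
  rcases h0.lt_or_eq with h | h
  · rcases h4.lt_or_eq with h' | h'
    · have : 0 < 4 * x * (4 - x) := mul_pos (by linarith) (by linarith)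
      nlinarith [sq_nonneg (4 - (1 + q) * x)]
    · subst h'; nlinarith [mul_pos hq hq]
  · subst h; norm_num

lemma mapF_phi {q c : ℝ} (hq : 0 < q) (h1 : -1 ≤ c) (h2 : c ≤ 1) :
    mapF q (phi q c) = phi q (2 * c ^ 2 - 1) := by
  have hP := phi_den_pos hq h1 h2
  have hP2 := phi_den_pos (c := 2 * c ^ 2 - 1) hq (by nlinarith) (by nlinarith)
  have e1 : 4 - phi q c = 4 * q * (1 + c) / ((1 - c) + q * (1 + c)) := by
    unfold phi; field_simp; ring
  have e2 : 4 - (1 + q) * phi q c = 8 * q * c / ((1 - c) + q * (1 + c)) := by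
    unfold phi; field_simp; ring
  have e3 : denE q (phi q c) =
      32 * q * ((1 - (2 * c ^ 2 - 1)) + q * (1 + (2 * c ^ 2 - 1)))
        / ((1 - c) + q * (1 + c)) ^ 2 := by
    unfold denE
    rw [e1, e2]; unfold phi; field_simp; ring
  unfold mapF
  rw [e3, e1]
  unfold phi
  rw [div_eq_div_iff (by positivity) hP2.ne']
  field_simp
  ring

lemma phi_mem {q c : ℝ} (hq : 0 < q) (h1 : -1 ≤ c) (h2 : c ≤ 1) :
    phi q c ∈ Icc (0:ℝ) 4 := by
  have hP := phi_den_pos hq h1 h2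
  have : 0 ≤ q * (1 + c) := mul_nonneg hq.le (by linarith)
  unfold phi
  constructor
  · exact div_nonneg (by linarith) hP.le
  · rw [div_le_iff₀ hP]; linarith

lemma iter_phi {q : ℝ} (hq : 0 < q) (n : ℕ) (t : ℝ) :
    (mapF q)^[n] (phi q (Real.cos t)) = phi q (Real.cos (2 ^ n * t)) := by
  induction n with
  | zero => simp
  | succ n ih =>
    rw [Function.iterate_succ_apply', ih, mapF_phi hq (Real.neg_one_le_cos _) (Real.cos_le_one _),
      ← Real.cos_two_mul, pow_succ]
    congr 2; ring

lemma phi_surj {q x : ℝ} (hq : 0 < q) (hx : x ∈ Icc (0:ℝ) 4) :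
    ∃ t : ℝ, phi q (Real.cos t) = x := by
  obtain ⟨h0, h4⟩ := hx
  have hD : 0 < (4 - x) + q * x := by
    rcases h4.lt_or_eq with h | h
    · have := mul_nonneg hq.le h0
      linarith
    · subst h; linarith
  have hqx := mul_nonneg hq.le h0
  have e1 : -1 ≤ (4 - (1 + q) * x) / ((4 - x) + q * x) := by
    rw [le_div_iff₀ hD]; nlinarith
  have e2 : (4 - (1 + q) * x) / ((4 - x) + q * x) ≤ 1 := by
    rw [div_le_iff₀ hD]; nlinarith
  refine ⟨Real.arccos ((4 - (1 + q) * x) / ((4 - x) + q * x)), ?_⟩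
  rw [Real.cos_arccos e1 e2]
  have hP := phi_den_pos hq e1 e2
  unfold phi
  rw [div_eq_iff hP.ne']
  field_simp
  ring

lemma mixF {q : ℝ} (hq : 0 < q) : IsTopologicallyMixingOn (mapF q) (Icc (0:ℝ) 4) := by
  rintro U V hU hV - ⟨V', hV', rfl⟩ ⟨u, hu⟩ ⟨v, hv⟩
  obtain ⟨s, rfl⟩ := phi_surj hq (hU hu)
  obtain ⟨t, rfl⟩ := phi_surj hq (hV hv)
  have hcont : Continuous fun t => phi q (Real.cos t) := by
    unfold phi
    refine Continuous.div (by fun_prop) (by fun_prop) fun t => ?_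
    exact (phi_den_pos hq (Real.neg_one_le_cos _) (Real.cos_le_one _)).ne'
  obtain ⟨e, he, hball⟩ := Metric.isOpen_iff.1 (hV'.preimage hcont) t hv.1
  obtain ⟨N, hN⟩ := pow_unbounded_of_one_lt (2 * Real.pi / e) (one_lt_two : (1:ℝ) < 2)
  refine ⟨N, fun n hn => ?_⟩
  have hn2 : (2:ℝ) ^ N ≤ 2 ^ n := pow_le_pow_right₀ (by norm_num) hn
  have hpi := Real.pi_pos
  have h2n : (0:ℝ) < 2 ^ n := by positivity
  have hlt : 2 * Real.pi < 2 ^ n * e := (div_lt_iff₀ he).1 (hN.trans_le hn2)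
  set m : ℤ := ⌊(2 ^ n * t - s) / (2 * Real.pi)⌋ with hm
  have hm1 : (m:ℝ) * (2 * Real.pi) ≤ 2 ^ n * t - s :=
    (le_div_iff₀ (by positivity)).1 (Int.floor_le _)
  have hm2 : 2 ^ n * t - s < ((m:ℝ) + 1) * (2 * Real.pi) :=
    (div_lt_iff₀ (by positivity)).1 (Int.lt_floor_add_one _)
  have hmul : (2:ℝ) ^ n * ((s + m * (2 * Real.pi)) / 2 ^ n) = s + m * (2 * Real.pi) := by
    field_simp
  refine ⟨phi q (Real.cos ((s + m * (2 * Real.pi)) / 2 ^ n)), ?_, ?_, ?_⟩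
  · rw [mem_preimage, iter_phi hq, hmul, Real.cos_add_int_mul_two_pi]
    exact hu
  · apply hball
    rw [Metric.mem_ball, Real.dist_eq, abs_lt]
    constructor
    · rw [lt_sub_iff_add_lt, lt_div_iff₀ h2n]; nlinarith
    · rw [sub_lt_iff_lt_add, div_lt_iff₀ h2n]; nlinarith
  · exact phi_mem hq (Real.neg_one_le_cos _) (Real.cos_le_one _)

lemma hasDerivF {q x : ℝ} (hq : 0 < q) (hx : x ∈ Icc (0:ℝ) 4) :
    HasDerivAt (mapF q)
      (64 * (4 - (1 + q) * x) * (4 - (1 - q) * x) / (denE q x) ^ 2) x := by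
  have hE := denE_pos hq hx.1 hx.2
  have hid := hasDerivAt_id x
  have h1 : HasDerivAt (fun x : ℝ => 16 * x * (4 - x)) (16 * (4 - x) + 16 * x * (-1)) x := by
    have := (hid.const_mul 16).mul (hid.const_sub 4)
    exact HasDerivAt.congr_deriv this (by simp)
  have h2 : HasDerivAt (fun x : ℝ => denE q x)
      (4 * (4 - x) + 4 * x * (-1) + 2 * (4 - (1 + q) * x) * (-(1 + q))) x := by
    unfold denE
    have := ((hid.const_mul 4).mul (hid.const_sub 4)).add
      (((hid.const_mul (1 + q)).const_sub 4).pow 2)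
    exact HasDerivAt.congr_deriv this (by simp)
  have h3 := h1.div h2 hE.ne'
  refine HasDerivAt.congr_deriv h3 ?_
  congr 1
  unfold denE
  ring

/-- For every integer `r ≥ 1` and every real `λ ≥ 14`, there is a `C^r` map of `[0,4]`
into itself which is topologically mixing and whose derivative has supremum of the
absolute value over `[0,4]` equal to `λ^r`. -/
theorem stmt_0 (r : ℕ) (hr : 1 ≤ r) (lam : ℝ) (hlam : 14 ≤ lam) :
    ∃ f : ℝ → ℝ,
      MapsTo f (Icc (0:ℝ) 4) (Icc (0:ℝ) 4) ∧
      ContDiffOn ℝ r f (Icc (0:ℝ) 4) ∧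
      IsTopologicallyMixingOn f (Icc (0:ℝ) 4) ∧
      sSup ((fun x => |derivWithin f (Icc (0:ℝ) 4) x|) '' Icc (0:ℝ) 4) = lam ^ r := by
  have hL : 14 ≤ lam ^ r := hlam.trans (le_self_pow₀ (by linarith) (by omega))
  obtain ⟨q, hq, hq1, hqL⟩ : ∃ q : ℝ, 0 < q ∧ q ≤ 1 ∧ lam ^ r = 4 / q ^ 2 := by
    have hs : 0 < √(lam ^ r) := Real.sqrt_pos.2 (by linarith)
    have hsq : √(lam ^ r) ^ 2 = lam ^ r := Real.sq_sqrt (by linarith)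
    refine ⟨2 / √(lam ^ r), by positivity, ?_, ?_⟩
    · rw [div_le_one hs]; nlinarith
    · rw [div_pow, hsq]
      have : lam ^ r ≠ 0 := by linarith
      field_simp
      norm_num
  have hder : ∀ x ∈ Icc (0:ℝ) 4, derivWithin (mapF q) (Icc (0:ℝ) 4) x =
      64 * (4 - (1 + q) * x) * (4 - (1 - q) * x) / (denE q x) ^ 2 := fun x hx =>
    (hasDerivF hq hx).hasDerivWithinAt.derivWithin (uniqueDiffOn_Icc (by norm_num) x hx)
  refine ⟨mapF q, ?_, ?_, mixF hq, ?_⟩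
  · intro x hx
    have hE := denE_pos hq hx.1 hx.2
    have h : 0 ≤ x * (4 - x) := mul_nonneg hx.1 (by linarith [hx.2])
    unfold mapF
    constructor
    · exact div_nonneg (by linarith) hE.le
    · rw [div_le_iff₀ hE]; unfold denE; nlinarith [sq_nonneg (4 - (1 + q) * x)]
  · have h2 : ContDiff ℝ r (denE q) := by unfold denE; fun_prop
    unfold mapF
    refine ContDiffOn.div (ContDiff.contDiffOn (by fun_prop)) h2.contDiffOn fun x hx => ?_
    exact (denE_pos hq hx.1 hx.2).ne'
  · rw [hqL]
    apply IsGreatest.csSup_eq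
    constructor
    · refine ⟨4, by norm_num, ?_⟩
      have h4 : derivWithin (mapF q) (Icc (0:ℝ) 4) 4 = -(4 / q ^ 2) := by
        rw [hder 4 (by norm_num)]
        have : denE q 4 = 16 * q ^ 2 := by unfold denE; ring
        rw [this]
        field_simp
        ring
      simp only [h4, abs_neg]
      exact abs_of_pos (by positivity)
    · rintro _ ⟨x, hx, rfl⟩
      have hE := denE_pos hq hx.1 hx.2
      simp only [hder x hx]
      obtain ⟨h0, h4⟩ := hx
      set D := 4 - (1 - q) * x with hD
      have hx4 : 0 ≤ x * (4 - x) := mul_nonneg h0 (by linarith)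
      have hqx : 0 ≤ q * x := mul_nonneg hq.le h0
      have hD4 : 4 * q ≤ D := by nlinarith
      have hDp : 0 < D := by linarith
      have hC : |4 - (1 + q) * x| ≤ D := by rw [abs_le]; constructor <;> nlinarith
      have hED : D ^ 2 ≤ denE q x := by
        have : denE q x - D ^ 2 = 4 * (1 - q) * (x * (4 - x)) := by rw [hD]; unfold denE; ring
        have h' : 0 ≤ (1 - q) * (x * (4 - x)) := mul_nonneg (by linarith) hx4
        linarith
      have hEq : 4 * q * D ≤ denE q x := by nlinarith
      rw [abs_div, abs_mul, abs_mul, abs_of_pos hDp, abs_of_pos (pow_pos hE 2),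
        abs_of_pos (by norm_num : (0:ℝ) < 64), div_le_div_iff₀ (by positivity) (by positivity)]
      have hsq : (4 * q * D) ^ 2 ≤ denE q x ^ 2 := by gcongr
      have hCD : |4 - (1 + q) * x| * D * q ^ 2 ≤ D * D * q ^ 2 := by gcongr
      nlinarith
end

section
/- For every integer r ≥ 1 and every real number λ ≥ 14, there exists a map f : [0,4] → [0,4] of class C^r which is topologically mixing and whose topological entropy equals log λ. -/
open Set Filter

/-- The maximal cardinality of an `(n,ε)`-separated subset of `I` for `f`. -/
noncomputable def sepNum (f : ℝ → ℝ) (I : Set ℝ) (n : ℕ) (ε : ℝ) : ℕ :=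
  sSup {m : ℕ | ∃ E : Finset ℝ, ↑E ⊆ I ∧
    (∀ x ∈ E, ∀ y ∈ E, x ≠ y → ∃ k < n, ε < |f^[k] x - f^[k] y|) ∧ E.card = m}

section partA
noncomputable def LL (l : ℝ) : ℝ := (l - 1) / 2
noncomputable def ww (l : ℝ) : ℝ := LL l / l
noncomputable def cc (l : ℝ) : ℝ := LL l - ww l

lemma LL_ge {l : ℝ} (hl : 14 ≤ l) : 6.5 ≤ LL l := by unfold LL; linarith
lemma ww_mul {l : ℝ} (hl : 14 ≤ l) : l * ww l = LL l := by
  unfold ww; field_simp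
lemma ww_lt {l : ℝ} (hl : 14 ≤ l) : ww l < 1 / 2 := by
  unfold ww LL; rw [div_lt_iff₀ (by linarith)]; linarith
lemma ww_gt {l : ℝ} (hl : 14 ≤ l) : 0.46 < ww l := by
  unfold ww LL; rw [lt_div_iff₀ (by linarith)]; linarith
lemma two_ww {l : ℝ} (hl : 14 ≤ l) : 2 * ww l = 1 - 1 / l := by
  unfold ww LL; field_simp
lemma cc_eq {l : ℝ} (hl : 14 ≤ l) : cc l = (l - 1) * ww l := by
  have := ww_mul hl
  unfold cc; linarith
lemma cc_gt {l : ℝ} (hl : 14 ≤ l) : 13 * ww l ≤ cc l := by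
  have := ww_gt hl
  rw [cc_eq hl]; nlinarith

structure ZSeq (l : ℝ) where
  z : ℕ → ℝ
  mono : StrictMono z
  z0 : z 0 = 0
  z1 : z 1 = 2 * ww l
  z2 : z 2 = 4 * ww l
  lim : Tendsto z atTop (nhds (cc l))
  gap : ∀ i, z (i+1) - z i = 2 * ww l ∨ ∃ k : ℕ, z (i+1) - z i = 2 * (l^(k+1))⁻¹

lemma step_exists {l : ℝ} (hl : 14 ≤ l) (R : ℝ) (h0 : 0 < R) (h1 : R ≤ cc l) :
    ∃ d : ℝ, 0 < d ∧ d < R ∧ R / l ≤ d ∧ (2 * ww l < R → d = 2 * ww l) ∧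
      (d = 2 * ww l ∨ ∃ k : ℕ, d = 2 * (l^(k+1))⁻¹) := by
  have hw := ww_gt hl
  have hw2 := ww_lt hl
  have hc := cc_eq hl
  by_cases h : 2 * ww l < R
  · refine ⟨2 * ww l, by linarith, h, ?_, fun _ => rfl, Or.inl rfl⟩
    rw [div_le_iff₀ (by linarith)]; nlinarith
  · obtain ⟨k, hk⟩ := exists_nat_pow_near_of_lt_one (x := R / 2) (y := l⁻¹) (by linarith) (by linarith)
      (by positivity) (inv_lt_one_of_one_lt₀ (by linarith))
    have e : (l^(k+1))⁻¹ = (l⁻¹)^(k+1) := by rw [inv_pow]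
    refine ⟨2 * (l^(k+1))⁻¹, by positivity, ?_, ?_, fun h' => absurd h' h, Or.inr ⟨k, rfl⟩⟩
    · rw [e]; linarith [hk.1]
    · rw [e, pow_succ, div_eq_mul_inv]
      have : 0 < l⁻¹ := by positivity
      nlinarith [hk.2]

lemma exists_zseq {l : ℝ} (hl : 14 ≤ l) : Nonempty (ZSeq l) := by
  have hw := ww_gt hl
  have hc := cc_gt hl
  choose! d hd0 hd1 hd2 hd3 hd4 using step_exists hl
  let R : ℕ → ℝ := fun n => Nat.rec (cc l) (fun _ x => x - d x) n
  have R0 : R 0 = cc l := rfl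
  have RS : ∀ n, R (n+1) = R n - d (R n) := fun n => rfl
  have hR : ∀ n, 0 < R n ∧ R n ≤ cc l := by
    intro n
    induction n with
    | zero => rw [R0]; constructor <;> linarith
    | succ n ih =>
      have := hd1 _ ih.1 ih.2
      have := hd0 _ ih.1 ih.2
      rw [RS]; constructor <;> linarith
  have hgeo : ∀ n, R n ≤ cc l * (1 - 1/l)^n := by
    intro n
    induction n with
    | zero => simp [R0]
    | succ n ih =>
      have h2 := hd2 _ (hR n).1 (hR n).2
      rw [RS, pow_succ]
      have h3 : (0:ℝ) ≤ 1 - 1/l := by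
        rw [sub_nonneg, div_le_iff₀ (by linarith)]; linarith
      have : R n - d (R n) ≤ R n * (1 - 1/l) := by
        have : R n * (1/l) = R n / l := by ring
        linarith
      nlinarith
  have hlim : Tendsto R atTop (nhds 0) := by
    have h3 : (0:ℝ) ≤ 1 - 1/l := by
      rw [sub_nonneg, div_le_iff₀ (by linarith)]; linarith
    have h4 : 1 - 1/l < 1 := by
      have : 0 < 1 / l := by positivity
      linarith
    have := (tendsto_pow_atTop_nhds_zero_of_lt_one h3 h4).const_mul (cc l)
    rw [mul_zero] at this
    exact tendsto_of_tendsto_of_tendsto_of_le_of_le tendsto_const_nhds this (fun n => (hR n).1.le) hgeo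
  have R1 : R 1 = cc l - 2 * ww l := by
    rw [show R 1 = R 0 - d (R 0) from RS 0, R0, hd3 _ (by linarith) le_rfl (by linarith)]
  have R2 : R 2 = cc l - 4 * ww l := by
    rw [show R 2 = R 1 - d (R 1) from RS 1, R1, hd3 _ (by linarith) (by linarith) (by linarith)]; ring
  refine ⟨⟨fun n => cc l - R n, ?_, by simp [R0], by rw [R1]; ring, by rw [R2]; ring, ?_, ?_⟩⟩
  · apply strictMono_nat_of_lt_succ
    intro n
    have := hd0 _ (hR n).1 (hR n).2
    simp only [RS]; linarith
  · simpa using hlim.const_sub (cc l)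
  · intro i
    have := hd4 _ (hR i).1 (hR i).2
    simp only [RS]
    simpa using this

namespace ZSeq
variable {l : ℝ} (Q : ZSeq l)

def Z : Set ℝ := insert (cc l) (range Q.z)

lemma compact : IsCompact Q.Z := Q.lim.isCompact_insert_range
lemma countable : Q.Z.Countable := (countable_range _).insert _
lemma nonempty : Q.Z.Nonempty := ⟨_, mem_insert _ _⟩
lemma z_lt (i) : Q.z i < cc l :=
  lt_of_lt_of_le (Q.mono (Nat.lt_succ_self i)) (Q.mono.monotone.ge_of_tendsto Q.lim _)
lemma z_nonneg (i) : 0 ≤ Q.z i := by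
  rw [← Q.z0]; exact Q.mono.monotone (Nat.zero_le _)

noncomputable def g (x : ℝ) : ℝ := l * (Metric.infDist x Q.Z + 2 * min x 0)

lemma g_of_nonneg {x : ℝ} (hx : 0 ≤ x) : Q.g x = l * Metric.infDist x Q.Z := by
  simp [g, hx]

lemma le_infDist {x d : ℝ} (h : ∀ y ∈ Q.Z, d ≤ |x - y|) : d ≤ Metric.infDist x Q.Z := by
  rw [Metric.le_infDist Q.nonempty]
  intro y hy
  simpa [Real.dist_eq] using h y hy

lemma infDist_le {x y : ℝ} (hy : y ∈ Q.Z) : Metric.infDist x Q.Z ≤ |x - y| := by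
  simpa [Real.dist_eq] using Metric.infDist_le_dist_of_mem (x := x) hy

lemma mem_z (i) : Q.z i ∈ Q.Z := mem_insert_of_mem _ ⟨i, rfl⟩
lemma mem_c : cc l ∈ Q.Z := mem_insert _ _

lemma cases_mem {y : ℝ} (hy : y ∈ Q.Z) (i : ℕ) : y ≤ Q.z i ∨ Q.z (i+1) ≤ y := by
  rcases hy with rfl | ⟨j, rfl⟩
  · right; exact (Q.z_lt _).le
  · rcases Nat.lt_or_ge i j with h | h
    · right; exact Q.mono.monotone h
    · left; exact Q.mono.monotone h

lemma mem_le {y : ℝ} (hy : y ∈ Q.Z) : 0 ≤ y ∧ y ≤ cc l := by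
  rcases hy with rfl | ⟨j, rfl⟩
  · exact ⟨(Q.z_nonneg 0).trans (Q.z_lt 0).le, le_rfl⟩
  · exact ⟨Q.z_nonneg j, (Q.z_lt j).le⟩

lemma infDist_gap {x : ℝ} {i : ℕ} (h1 : Q.z i ≤ x) (h2 : x ≤ Q.z (i+1)) :
    Metric.infDist x Q.Z = min (x - Q.z i) (Q.z (i+1) - x) := by
  apply le_antisymm
  · apply le_min
    · have := Q.infDist_le (x := x) (Q.mem_z i)
      rwa [abs_of_nonneg (by linarith)] at this
    · have := Q.infDist_le (x := x) (Q.mem_z (i+1))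
      rwa [abs_of_nonpos (by linarith), neg_sub] at this
  · apply Q.le_infDist
    intro y hy
    rcases Q.cases_mem hy i with h | h
    · exact (min_le_left _ _).trans (by rw [abs_of_nonneg (by linarith)]; linarith)
    · exact (min_le_right _ _).trans (by rw [abs_of_nonpos (by linarith)]; linarith)

/-- up-lap -/
lemma g_up {x : ℝ} {i : ℕ} (h1 : Q.z i ≤ x) (h2 : x ≤ (Q.z i + Q.z (i+1))/2) :
    Q.g x = l * (x - Q.z i) := by
  have := Q.mono (Nat.lt_succ_self i)
  have h0 := Q.z_nonneg i
  rw [g_of_nonneg _ (by linarith), infDist_gap _ h1 (by linarith), min_eq_left (by linarith)]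

lemma g_down {x : ℝ} {i : ℕ} (h1 : (Q.z i + Q.z (i+1))/2 ≤ x) (h2 : x ≤ Q.z (i+1)) :
    Q.g x = l * (Q.z (i+1) - x) := by
  have := Q.mono (Nat.lt_succ_self i)
  have h0 := Q.z_nonneg i
  rw [g_of_nonneg _ (by linarith), infDist_gap _ (i := i) (by linarith [show Q.z i < Q.z (i+1) from this]) (by linarith), min_eq_right (by linarith)]

lemma g_last {x : ℝ} (h1 : cc l ≤ x) : Q.g x = l * (x - cc l) := by
  have hc := Q.mem_le Q.mem_c
  rw [g_of_nonneg _ (by linarith)]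
  congr 1
  apply le_antisymm
  · have := Q.infDist_le (x := x) Q.mem_c
    rwa [abs_of_nonneg (by linarith)] at this
  · apply Q.le_infDist
    intro y hy
    have := Q.mem_le hy
    rw [abs_of_nonneg (by linarith)]; linarith

lemma g_neg {x : ℝ} (h1 : x ≤ 0) : Q.g x = l * x := by
  have : Metric.infDist x Q.Z = -x := by
    apply le_antisymm
    · have := Q.infDist_le (x := x) (Q.mem_z 0)
      rwa [Q.z0, sub_zero, abs_of_nonpos h1] at this
    · apply Q.le_infDist
      intro y hy
      have := Q.mem_le hy
      rw [abs_of_nonpos (by linarith)]; linarith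
  rw [g, this, min_eq_left h1]; ring

/-- location -/
lemma locate {x : ℝ} (h0 : 0 ≤ x) (h1 : x < cc l) : ∃ i, Q.z i ≤ x ∧ x < Q.z (i+1) := by
  have : ∃ j, x < Q.z j := ((tendsto_order.1 Q.lim).1 x h1).exists
  classical
  let j := Nat.find this
  have hj : x < Q.z j := Nat.find_spec this
  rcases Nat.eq_zero_or_pos j with h | h
  · rw [h, Q.z0] at hj; linarith
  · refine ⟨j - 1, ?_, ?_⟩
    · exact not_lt.1 (Nat.find_min this (Nat.sub_lt h one_pos))
    · rwa [Nat.sub_add_cancel h]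

lemma g_first (_hl : 14 ≤ l) {x : ℝ} (h2 : x ≤ ww l) : Q.g x = l * x := by
  rcases le_total x 0 with h | h
  · exact Q.g_neg h
  · have := Q.g_up (x := x) (i := 0) (by rw [Q.z0]; exact h) (by rw [Q.z0, Q.z1]; linarith)
    rw [this, Q.z0, sub_zero]

lemma g_third (hl : 14 ≤ l) {x : ℝ} (h1 : 2 * ww l ≤ x) (h2 : x ≤ 3 * ww l) :
    Q.g x = 1 + l * (x - 1) := by
  have := Q.g_up (x := x) (i := 1) (by rw [Q.z1]; exact h1) (by rw [Q.z1, Q.z2]; linarith)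
  rw [this, Q.z1, two_ww hl]
  field_simp; ring

lemma g_L (hl : 14 ≤ l) {x : ℝ} (h1 : cc l ≤ x) : Q.g x = LL l + l * (x - LL l) := by
  rw [Q.g_last h1]
  have := ww_mul hl
  unfold cc; linarith

lemma g_lip_on {x y : ℝ} (hl : 14 ≤ l) (hx : 0 ≤ x) (hy : 0 ≤ y) :
    |Q.g x - Q.g y| ≤ l * |x - y| := by
  rw [g_of_nonneg _ hx, g_of_nonneg _ hy, ← mul_sub, abs_mul, abs_of_nonneg (by linarith : (0:ℝ) ≤ l)]
  have := (Metric.lipschitz_infDist_pt Q.Z).dist_le_mul x y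
  rw [Real.dist_eq, Real.dist_eq] at this
  simp only [NNReal.coe_one, one_mul] at this
  exact mul_le_mul_of_nonneg_left this (by linarith)

lemma g_lip (hl : 14 ≤ l) : ∃ K, LipschitzWith K Q.g := by
  refine ⟨_, LipschitzWith.of_dist_le' (K := l * 3) ?_⟩
  intro x y
  rw [Real.dist_eq, Real.dist_eq]
  unfold g
  have := (Metric.lipschitz_infDist_pt Q.Z).dist_le_mul x y
  rw [Real.dist_eq, Real.dist_eq] at this
  have h2 : |min x 0 - min y 0| ≤ |x - y| := by
    simpa using abs_min_sub_min_le_max x 0 y 0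
  rw [← mul_sub, abs_mul, abs_of_nonneg (by linarith : (0:ℝ) ≤ l), mul_assoc]
  gcongr
  have e : Metric.infDist x Q.Z + 2 * min x 0 - (Metric.infDist y Q.Z + 2 * min y 0)
    = (Metric.infDist x Q.Z - Metric.infDist y Q.Z) + 2 * (min x 0 - min y 0) := by ring
  rw [e]
  refine (abs_add_le _ _).trans ?_
  rw [abs_mul, abs_two]
  simp only [NNReal.coe_one] at this
  linarith

lemma g_cont (hl : 14 ≤ l) : Continuous Q.g := by
  obtain ⟨K, hK⟩ := Q.g_lip hl
  exact hK.continuous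

/-- Singular set. -/
def Sing (l : ℝ) : Set ℝ := {x | x = 0 ∨ x = LL l ∨ ∃ k : ℕ, x = (l^k)⁻¹}

lemma peak (hl : 14 ≤ l) (i : ℕ) : Q.g ((Q.z i + Q.z (i+1))/2) ∈ Sing l := by
  have hm := Q.mono (Nat.lt_succ_self i)
  rw [Q.g_up (i := i) (by linarith) le_rfl]
  rcases Q.gap i with h | ⟨k, h⟩
  · right; left
    rw [← ww_mul hl]
    have : (Q.z i + Q.z (i+1))/2 - Q.z i = ww l := by linarith
    rw [this]
  · right; right
    refine ⟨k, ?_⟩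
    have : (Q.z i + Q.z (i+1))/2 - Q.z i = (l^(k+1))⁻¹ := by linarith
    rw [this, pow_succ]
    field_simp

lemma dichotomy (hl : 14 ≤ l) (x : ℝ) :
    (∃ a b, Q.g =ᶠ[nhds x] fun y => a * y + b) ∨ Q.g x ∈ Sing l := by
  have hw := ww_gt hl
  rcases lt_or_ge x (ww l) with h | h
  · left
    refine ⟨l, 0, ?_⟩
    filter_upwards [Iio_mem_nhds h] with y hy
    rw [Q.g_first hl (le_of_lt hy)]; ring
  rcases lt_trichotomy (cc l) x with h' | h' | h'
  · left
    refine ⟨l, - l * cc l, ?_⟩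
    filter_upwards [Ioi_mem_nhds h'] with y hy
    rw [Q.g_last (le_of_lt hy)]; ring
  · right; left
    rw [Q.g_last h'.le, h']; simp
  · obtain ⟨i, hi1, hi2⟩ := Q.locate (by linarith) h'
    rcases hi1.eq_or_lt with hi1 | hi1
    · right; left
      have := Q.mono (Nat.lt_succ_self i)
      rw [← hi1, Q.g_up le_rfl (by linarith)]; simp
    rcases lt_trichotomy x ((Q.z i + Q.z (i+1))/2) with h3 | h3 | h3
    · left
      refine ⟨l, - l * Q.z i, ?_⟩
      filter_upwards [Ioo_mem_nhds hi1 h3] with y hy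
      rw [Q.g_up hy.1.le hy.2.le]; ring
    · right
      rw [h3]; exact Q.peak hl i
    · left
      refine ⟨-l, l * Q.z (i+1), ?_⟩
      filter_upwards [Ioo_mem_nhds h3 hi2] with y hy
      rw [Q.g_down hy.1.le hy.2.le]; ring

lemma half_gap_le (hl : 14 ≤ l) (i : ℕ) : Q.z (i+1) - Q.z i ≤ 2 * ww l := by
  rcases Q.gap i with h | ⟨k, h⟩
  · exact h.le
  · rw [h]
    have h1 : (l^(k+1))⁻¹ ≤ l⁻¹ := by
      apply inv_anti₀ (by linarith)
      exact le_self_pow₀ (by linarith) (by omega)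
    have h2 : l⁻¹ ≤ 14⁻¹ := inv_anti₀ (by norm_num) hl
    have := ww_gt hl
    linarith

lemma mapsTo (hl : 14 ≤ l) : MapsTo Q.g (Icc 0 (LL l)) (Icc 0 (LL l)) := by
  intro x hx
  have hw := ww_mul hl
  constructor
  · rw [Q.g_of_nonneg hx.1]
    exact mul_nonneg (by linarith) Metric.infDist_nonneg
  · rcases lt_or_ge x (cc l) with h | h
    · obtain ⟨i, hi1, hi2⟩ := Q.locate hx.1 h
      rw [Q.g_of_nonneg hx.1, Q.infDist_gap hi1 hi2.le, ← hw]
      have := Q.half_gap_le hl i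
      have : min (x - Q.z i) (Q.z (i + 1) - x) ≤ ww l := by
        rcases le_total (x - Q.z i) (Q.z (i + 1) - x) with h | h
        · rw [min_eq_left h]; linarith
        · rw [min_eq_right h]; linarith
      gcongr
    · rw [Q.g_L hl h]
      nlinarith [hx.2]

end ZSeq
end partA

section partB
lemma selfsim_bound {l : ℝ} (hl : 1 < l) (n : ℕ) (h : ℝ → ℝ)
    (hc : ∀ x ≠ 0, ContinuousAt h x) {δ : ℝ} (hδ : 0 < δ)
    (hs : ∀ x, |x| ≤ δ → h (l * x) = l^n * h x) (h0 : h 0 = 0) :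
    ∃ C, ∀ x, |x| ≤ δ → |h x| ≤ C * |x|^n := by
  have hcomp : IsCompact (Icc δ (l*δ) ∪ Icc (-(l*δ)) (-δ)) := isCompact_Icc.union isCompact_Icc
  have hne : ∀ x ∈ (Icc δ (l*δ) ∪ Icc (-(l*δ)) (-δ)), x ≠ 0 := by
    rintro x (hx | hx)
    · exact (lt_of_lt_of_le hδ hx.1).ne'
    · have := hx.2; intro h; linarith
  obtain ⟨M, hM⟩ := hcomp.exists_bound_of_continuousOn (f := h)
    (fun x hx => (hc x (hne x hx)).continuousWithinAt)
  have hM0 : 0 ≤ M := (norm_nonneg _).trans (hM δ (Or.inl ⟨le_rfl, by nlinarith⟩))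
  have hit : ∀ (k : ℕ) (x : ℝ), l^k * |x| ≤ l * δ → h (l^k * x) = (l^k)^n * h x := by
    intro k
    induction k with
    | zero => intro x _; simp
    | succ k ih =>
      intro x hx
      have hk : l^k * |x| ≤ δ := by
        rw [pow_succ, mul_comm _ l, mul_assoc] at hx
        exact le_of_mul_le_mul_left hx (by linarith)
      rw [pow_succ, mul_comm _ l, mul_assoc, hs _ (by rwa [abs_mul, abs_of_nonneg (by positivity)]),
        ih x (by nlinarith), mul_pow]
      ring
  refine ⟨M / δ^n, fun x hx => ?_⟩
  rcases eq_or_ne x 0 with rfl | hx0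
  · rw [h0, abs_zero]; positivity
  have hxp : 0 < |x| := abs_pos.2 hx0
  obtain ⟨k, hk1, hk2⟩ := exists_nat_pow_near (x := δ / |x|) (y := l) ((one_le_div hxp).2 hx) hl
  rw [le_div_iff₀ hxp] at hk1
  rw [div_lt_iff₀ hxp] at hk2
  have hk3 : l^(k+1) * |x| ≤ l * δ := by rw [pow_succ]; nlinarith
  have e := hit (k+1) x hk3
  have hb : |h (l^(k+1) * x)| ≤ M := by
    apply hM
    rcases le_total 0 x with h | h
    · rw [abs_of_nonneg h] at hk2 hk3
      left; exact ⟨hk2.le, hk3⟩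
    · rw [abs_of_nonpos h] at hk2 hk3
      right; constructor <;> linarith
  rw [e, abs_mul, abs_of_nonneg (by positivity)] at hb
  rw [div_mul_eq_mul_div, le_div_iff₀ (by positivity)]
  calc |h x| * δ^n ≤ |h x| * (l^(k+1) * |x|)^n := by gcongr
    _ = ((l^(k+1))^n * |h x|) * |x|^n := by rw [mul_pow]; ring
    _ ≤ M * |x|^n := by gcongr

lemma contDiffAt_deriv_top {h : ℝ → ℝ} {x : ℝ} (hc : ContDiffAt ℝ (⊤ : ℕ∞) h x) :
    ContDiffAt ℝ (⊤ : ℕ∞) (deriv h) x := by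
  have := (hc.fderiv_right (m := (⊤ : ℕ∞)) (by simp)).clm_apply (contDiffAt_const (c := (1:ℝ)))
  exact this

lemma selfsim_contDiff {l : ℝ} (hl : 1 < l) (n : ℕ) : ∀ (h : ℝ → ℝ)
    (_ : ∀ x ≠ 0, ContDiffAt ℝ (⊤ : ℕ∞) h x) (δ : ℝ) (_ : 0 < δ)
    (_ : ∀ x, |x| ≤ δ → h (l * x) = l^(n+1) * h x) (_ : h 0 = 0),
    ContDiff ℝ n h ∧ ∀ j ≤ n, iteratedDeriv j h 0 = 0 := by
  induction n with
  | zero =>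
    intro h hc δ hδ hs h0
    obtain ⟨C, hC⟩ := selfsim_bound hl 1 h (fun x hx => (hc x hx).continuousAt) hδ hs h0
    constructor
    · simp only [Nat.cast_zero, contDiff_zero]
      rw [continuous_iff_continuousAt]
      intro x
      rcases eq_or_ne x 0 with rfl | hx
      · rw [ContinuousAt, h0]
        refine squeeze_zero_norm' (a := fun x => C * |x|^1) ?_ ?_
        · filter_upwards [Metric.closedBall_mem_nhds (0:ℝ) hδ] with x hx
          rw [Metric.mem_closedBall, Real.dist_eq, sub_zero] at hx
          exact hC x hx
        · have : Continuous (fun x : ℝ => C * |x|^1) := by fun_prop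
          simpa using this.tendsto 0
      · exact (hc x hx).continuousAt
    · intro j hj
      obtain rfl : j = 0 := by omega
      simpa using h0
  | succ n ih =>
    intro h hc δ hδ hs h0
    obtain ⟨C, hC⟩ := selfsim_bound hl (n+2) h (fun x hx => (hc x hx).continuousAt) hδ hs h0
    have hd0 : HasDerivAt h 0 0 := by
      rw [hasDerivAt_iff_isLittleO_nhds_zero]
      simp only [zero_add, h0, sub_zero, smul_zero]
      have h1 : h =O[nhds 0] (fun x : ℝ => x^(n+2)) := by
        apply Asymptotics.IsBigO.of_bound C
        filter_upwards [Metric.closedBall_mem_nhds (0:ℝ) hδ] with x hx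
        rw [Metric.mem_closedBall, Real.dist_eq, sub_zero] at hx
        rw [norm_pow]
        exact hC x hx
      refine h1.trans_isLittleO ?_
      simpa using Asymptotics.isLittleO_pow_pow (𝕜 := ℝ) (show 1 < n+2 by omega)
    have hdiff : Differentiable ℝ h := by
      intro x
      rcases eq_or_ne x 0 with rfl | hx
      · exact hd0.differentiableAt
      · exact (hc x hx).differentiableAt (by simp)
    have key := ih (deriv h) (fun x hx => contDiffAt_deriv_top (hc x hx)) (δ/2) (by linarith) ?_ hd0.deriv
    · constructor
      · have := (contDiff_succ_iff_deriv (𝕜 := ℝ) (n := (n : WithTop ℕ∞)) (f := h)).2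
          ⟨hdiff, by simp, key.1⟩
        exact_mod_cast this
      · intro j hj
        cases j with
        | zero => simpa using h0
        | succ j => rw [iteratedDeriv_succ']; exact key.2 j (by omega)
    · intro x hx
      have e : (fun y => h (l * y)) =ᶠ[nhds x] fun y => l^(n+2) * h y := by
        have : ∀ᶠ y in nhds x, |y| < δ := by
          have : Continuous (fun y : ℝ => |y|) := continuous_abs
          exact this.continuousAt.eventually (gt_mem_nhds (by linarith))
        filter_upwards [this] with y hy
        exact hs y hy.le
      have e2 := e.deriv_eq
      rw [deriv_const_mul _ (hdiff x), deriv_comp_mul_left, smul_eq_mul] at e2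
      have : l ≠ 0 := by linarith
      apply mul_left_cancel₀ this
      rw [e2]; ring

noncomputable def E1 (l : ℝ) (n : ℕ) (y : ℝ) : ℝ :=
  (1 - Real.smoothTransition (3 * (y / l) - 1)) * (y - 1)^n
    + Real.smoothTransition (3 * (y / l) - 1) * (y - l)^n

noncomputable def HH (l : ℝ) (n : ℕ) (x : ℝ) : ℝ :=
  if x ≤ 0 then x^n else
    (l ^ (⌊Real.logb l x⌋))^n * E1 l n (x / l ^ (⌊Real.logb l x⌋))

lemma E1_contDiff (l : ℝ) (n : ℕ) : ContDiff ℝ (⊤ : ℕ∞) (E1 l n) := by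
  unfold E1
  have : ContDiff ℝ (⊤ : ℕ∞) (fun y : ℝ => Real.smoothTransition (3 * (y / l) - 1)) :=
    Real.smoothTransition.contDiff.comp (by fun_prop)
  fun_prop


lemma HH_scale {l : ℝ} (hl : 14 ≤ l) (n : ℕ) (hn0 : n ≠ 0) (x : ℝ) : HH l n (l * x) = l^n * HH l n x := by
  unfold HH
  rcases lt_or_ge 0 x with h | h
  · have hlx : 0 < l * x := by positivity
    rw [if_neg (not_le.2 hlx), if_neg (not_le.2 h)]
    have e : Real.logb l (l * x) = Real.logb l x + 1 := by
      rw [Real.logb_mul (by positivity) h.ne', Real.logb_self_eq_one (by linarith)]; ring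
    rw [e, Int.floor_add_one, zpow_add_one₀ (by positivity), mul_pow]
    have : l * x / (l ^ ⌊Real.logb l x⌋ * l) = x / l ^ ⌊Real.logb l x⌋ := by
      field_simp
    rw [this]; ring
  · rw [if_pos (by nlinarith), if_pos h, mul_pow]

lemma HH_zscale {l : ℝ} (hl : 14 ≤ l) (n : ℕ) (hn0 : n ≠ 0) (k : ℤ) (x : ℝ) : HH l n (l^k * x) = (l^k)^n * HH l n x := by
  have hl0 : l ≠ 0 := by linarith
  induction k using Int.induction_on with
  | zero => simp
  | succ k ih =>
    rw [zpow_add_one₀ hl0, mul_comm _ l, mul_assoc, HH_scale hl n hn0, ih]; ring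
  | pred k ih =>
    have := HH_scale hl n hn0 (l^(-(k:ℤ) - 1) * x)
    rw [← mul_assoc, ← zpow_one_add₀ hl0, show 1 + (-(k:ℤ) - 1) = -k by ring, ih] at this
    have h2 : l^(-(k:ℤ)) = l * l^(-(k:ℤ) - 1) := by
      rw [← zpow_one_add₀ hl0]; ring_nf
    rw [h2, mul_pow, mul_assoc] at this
    exact (mul_left_cancel₀ (pow_ne_zero _ hl0) this).symm

lemma HH_base {l : ℝ} (hl : 14 ≤ l) (n : ℕ) {x : ℝ} (h1 : 1 ≤ x) (h2 : x < l) : HH l n x = E1 l n x := by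
  have : ⌊Real.logb l x⌋ = 0 := by
    rw [Int.floor_eq_iff]
    constructor
    · simpa using Real.logb_nonneg (by linarith) h1
    · have := Real.logb_lt_logb (b := l) (by linarith) (by linarith) h2
      rw [Real.logb_self_eq_one (by linarith)] at this
      simpa using this
  unfold HH
  rw [if_neg (by linarith), this]; simp

lemma E1_low {l : ℝ} (n : ℕ) {x : ℝ} (hl : 14 ≤ l) (h : x ≤ l / 3) : E1 l n x = (x-1)^n := by
  unfold E1
  rw [Real.smoothTransition.zero_of_nonpos]
  · ring
  · have : x / l ≤ 1 / 3 := by rw [div_le_iff₀ (by linarith)]; linarith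
    linarith

lemma E1_high {l : ℝ} (n : ℕ) {x : ℝ} (hl : 14 ≤ l) (h : 2 * l / 3 ≤ x) : E1 l n x = (x-l)^n := by
  unfold E1
  rw [Real.smoothTransition.one_of_one_le]
  · ring
  · have : 2 / 3 ≤ x / l := by rw [le_div_iff₀ (by linarith)]; linarith
    linarith

lemma HH_base' {l : ℝ} (hl : 14 ≤ l) (n : ℕ) (hn0 : n ≠ 0) {x : ℝ} (h1 : 2/3 ≤ x) (h2 : x < l) : HH l n x = E1 l n x := by
  rcases le_or_gt 1 x with h | h
  · exact HH_base hl n h h2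
  · have := HH_scale hl n hn0 x
    rw [HH_base hl n (by nlinarith) (by nlinarith), E1_high n hl (by nlinarith)] at this
    rw [E1_low n hl (by linarith)]
    have h3 : l * x - l = l * (x - 1) := by ring
    rw [h3, mul_pow] at this
    exact (mul_left_cancel₀ (by positivity) this).symm

lemma HH_one {l : ℝ} (hl : 14 ≤ l) (n : ℕ) (hn0 : n ≠ 0) {x : ℝ} (h1 : 2/3 ≤ x) (h2 : x ≤ 2) : HH l n x = (x-1)^n := by
  rw [HH_base' hl n hn0 h1 (by linarith), E1_low n hl (by linarith)]

lemma HH_contDiffAt {l : ℝ} (hl : 14 ≤ l) (n : ℕ) (hn0 : n ≠ 0) {x : ℝ} (hx : x ≠ 0) : ContDiffAt ℝ (⊤ : ℕ∞) (HH l n) x := by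
  rcases lt_or_gt_of_ne hx with h | h
  · have : HH l n =ᶠ[nhds x] fun y => y^n := by
      filter_upwards [Iio_mem_nhds h] with y hy
      unfold HH; rw [if_pos (le_of_lt hy)]
    exact ContDiffAt.congr_of_eventuallyEq (by fun_prop) this
  · obtain ⟨k, hk1, hk2⟩ := exists_mem_Ico_zpow h (show 1 < l by linarith)
    have hkp : 0 < l^k := by positivity
    rw [zpow_add_one₀ (by positivity)] at hk2
    have hm : x / l^k ∈ Ioo (2/3) l := by
      constructor
      · rw [lt_div_iff₀ hkp]; linarith
      · rw [div_lt_iff₀ hkp]; linarith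
    have : HH l n =ᶠ[nhds x] fun y => (l^k)^n * E1 l n (y / l^k) := by
      have hcont : ContinuousAt (fun y => y / l^k) x := by fun_prop
      filter_upwards [hcont.eventually (Ioo_mem_nhds hm.1 hm.2)] with y hy
      rw [← HH_base' hl n hn0 hy.1.le hy.2, ← HH_zscale hl n hn0]
      congr 1; field_simp
    refine ContDiffAt.congr_of_eventuallyEq ?_ this
    have := (E1_contDiff l n).comp (g := E1 l n) (f := fun y => y / l^k) (by fun_prop)
    exact (contDiff_const.mul this).contDiffAt

lemma HH_nonneg {l : ℝ} (hl : 14 ≤ l) (n : ℕ) (hn : Even n) (x : ℝ) : 0 ≤ HH l n x := by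
  unfold HH E1
  split_ifs
  · exact hn.pow_nonneg _
  · have := Real.smoothTransition.nonneg (3 * (x / l ^ ⌊Real.logb l x⌋ / l) - 1)
    have := Real.smoothTransition.le_one (3 * (x / l ^ ⌊Real.logb l x⌋ / l) - 1)
    have := hn.pow_nonneg (x / l ^ ⌊Real.logb l x⌋ - 1)
    have := hn.pow_nonneg (x / l ^ ⌊Real.logb l x⌋ - l)
    have : 0 ≤ (l ^ ⌊Real.logb l x⌋)^n := by positivity
    apply mul_nonneg this
    apply add_nonneg <;> apply mul_nonneg <;> linarith

lemma HH_zero {l : ℝ} (hl : 14 ≤ l) (n : ℕ) (hn : Even n) (hn0 : n ≠ 0) {x : ℝ} (hx : HH l n x = 0) : x = 0 ∨ ∃ k : ℤ, x = l^k := by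
  rcases lt_or_ge 0 x with h | h
  · right
    obtain ⟨k, hk1, hk2⟩ := exists_mem_Ico_zpow h (show 1 < l by linarith)
    have hkp : 0 < l^k := by positivity
    rw [zpow_add_one₀ (by positivity)] at hk2
    have e : x = l^k * (x / l^k) := by field_simp
    have hy1 : 1 ≤ x / l^k := by rw [le_div_iff₀ hkp]; linarith
    have hy2 : x / l^k < l := by rw [div_lt_iff₀ hkp]; linarith
    rw [e, HH_zscale hl n hn0, HH_base hl n hy1 hy2] at hx
    have hx2 := (mul_eq_zero.1 hx).resolve_left (by positivity)
    set y := x / l^k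
    have a1 := Real.smoothTransition.nonneg (3 * (y / l) - 1)
    have a2 := Real.smoothTransition.le_one (3 * (y / l) - 1)
    have a3 : 0 < (y - l)^n := hn.pow_pos (by linarith)
    refine ⟨k, ?_⟩
    by_contra hne
    have hy : y - 1 ≠ 0 := by
      intro h1
      apply hne
      rw [e]
      have : y = 1 := by linarith
      rw [this, mul_one]
    have a4 : 0 < (y - 1)^n := hn.pow_pos hy
    unfold E1 at hx2
    have b1 : 0 ≤ (1 - Real.smoothTransition (3 * (y / l) - 1)) * (y - 1)^n :=
      mul_nonneg (by linarith) a4.le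
    have b2 : 0 ≤ Real.smoothTransition (3 * (y / l) - 1) * (y - l)^n := mul_nonneg a1 a3.le
    have c1 := (mul_eq_zero.1 (show _ = 0 by linarith : (1 - Real.smoothTransition (3 * (y / l) - 1)) * (y - 1)^n = 0)).resolve_right a4.ne'
    have c2 := (mul_eq_zero.1 (show _ = 0 by linarith : Real.smoothTransition (3 * (y / l) - 1) * (y - l)^n = 0)).resolve_right a3.ne'
    linarith
  · left
    unfold HH at hx
    rw [if_pos h] at hx
    exact (pow_eq_zero_iff hn0).1 hx

noncomputable def hh (l : ℝ) (n : ℕ) (x : ℝ) : ℝ :=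
  (1 - Real.smoothTransition (x - 2)) * HH l n x + Real.smoothTransition (x - 2) * (x - LL l)^n

lemma hh_low {l : ℝ} (n : ℕ) {x : ℝ} (h : x ≤ 2) : hh l n x = HH l n x := by
  unfold hh; rw [Real.smoothTransition.zero_of_nonpos (by linarith)]; ring

lemma hh_high {l : ℝ} (n : ℕ) {x : ℝ} (h : 3 ≤ x) : hh l n x = (x - LL l)^n := by
  unfold hh; rw [Real.smoothTransition.one_of_one_le (by linarith)]; ring

lemma hh_scale {l : ℝ} (hl : 14 ≤ l) (n : ℕ) (hn0 : n ≠ 0) {x : ℝ} (h : x ≤ 2 / l) : hh l n (l * x) = l^n * hh l n x := by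
  rw [le_div_iff₀ (by linarith)] at h
  have : x ≤ 2 := by
    by_contra hx
    nlinarith
  rw [hh_low n (by linarith), hh_low n this, HH_scale hl n hn0]

lemma hh_contDiffAt {l : ℝ} (hl : 14 ≤ l) (n : ℕ) (hn0 : n ≠ 0) {x : ℝ} (hx : x ≠ 0) : ContDiffAt ℝ (⊤ : ℕ∞) (hh l n) x := by
  unfold hh
  have h1 : ContDiffAt ℝ (⊤ : ℕ∞) (fun y : ℝ => Real.smoothTransition (y - 2)) x :=
    (Real.smoothTransition.contDiff.comp (by fun_prop : ContDiff ℝ (⊤ : ℕ∞) fun y : ℝ => y - 2)).contDiffAt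
  have h2 := HH_contDiffAt hl n hn0 hx
  fun_prop

lemma hh_nonneg {l : ℝ} (hl : 14 ≤ l) (n : ℕ) (hn : Even n) (x : ℝ) : 0 ≤ hh l n x := by
  have := Real.smoothTransition.nonneg (x - 2)
  have := Real.smoothTransition.le_one (x - 2)
  have := hn.pow_nonneg (x - LL l)
  have := HH_nonneg hl n hn x
  unfold hh
  apply add_nonneg <;> apply mul_nonneg <;> linarith

lemma hh_zero {l : ℝ} (hl : 14 ≤ l) (n : ℕ) (hn : Even n) (hn0 : n ≠ 0) {x : ℝ} (hx : hh l n x = 0) : x ∈ ZSeq.Sing l := by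
  have hL := LL_ge hl
  rcases le_or_gt x 2 with h | h
  · rw [hh_low n h] at hx
    rcases HH_zero hl n hn hn0 hx with h1 | ⟨k, hk⟩
    · left; exact h1
    · right; right
      have hk0 : k ≤ 0 := by
        by_contra hk0
        have : l^(1:ℤ) ≤ l^k := zpow_le_zpow_right₀ (by linarith) (by omega)
        rw [zpow_one] at this; linarith
      refine ⟨k.natAbs, ?_⟩
      rw [hk, ← zpow_natCast, ← zpow_neg]
      congr 1; omega
  · right; left
    have a1 := Real.smoothTransition.pos_of_pos (show 0 < x - 2 by linarith)
    have a2 := Real.smoothTransition.le_one (x - 2)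
    have a3 := HH_nonneg hl n hn x
    by_contra hne
    have a4 : 0 < (x - LL l)^n := hn.pow_pos (sub_ne_zero.2 hne)
    unfold hh at hx
    have : 0 ≤ (1 - Real.smoothTransition (x - 2)) * HH l n x := mul_nonneg (by linarith) a3
    nlinarith

lemma hh_near {l : ℝ} (hl : 14 ≤ l) (n : ℕ) (hn0 : n ≠ 0) (k : ℕ) : ∀ {x : ℝ} (_ : 2/3 * (l^k)⁻¹ ≤ x) (_ : x ≤ 2 * (l^k)⁻¹),
    hh l n x = (x - (l^k)⁻¹)^n := by
  have hlp : 0 < l := by linarith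
  induction k with
  | zero =>
    intro x h1 h2
    simp only [pow_zero, inv_one, mul_one] at *
    rw [hh_low n h2, HH_one hl n hn0 h1 h2]
  | succ k ih =>
    intro x h1 h2
    have e : (l^k)⁻¹ = l * (l^(k+1))⁻¹ := by rw [pow_succ]; field_simp
    have h3 : x ≤ 2 / l := by
      refine h2.trans ?_
      rw [div_eq_mul_inv]
      gcongr
      exact le_self_pow₀ (by linarith) (by omega)
    have := hh_scale hl n hn0 h3
    rw [ih (by rw [e]; nlinarith) (by rw [e]; nlinarith), e, ← mul_sub, mul_pow] at this
    exact (mul_left_cancel₀ (by positivity) this).symm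


lemma Sing_countable (l : ℝ) : (ZSeq.Sing l).Countable := by
  have : ZSeq.Sing l = {0} ∪ ({LL l} ∪ range (fun k : ℕ => (l^k)⁻¹)) := by
    ext x; simp [ZSeq.Sing, eq_comm]; tauto
  rw [this]
  exact (countable_singleton _).union ((countable_singleton _).union (countable_range _))

lemma iteratedDeriv_shift_pow (n : ℕ) (a : ℝ) (j : ℕ) (hj : j < n) :
    iteratedDeriv j (fun x => (x - a)^n) a = 0 := by
  have := congrFun (iteratedDeriv_comp_sub_const j (fun x : ℝ => x^n) a) a
  rw [this]
  simp only [sub_self]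
  rw [iteratedDeriv_eq_iterate, iter_deriv_pow]
  have : n - j ≠ 0 := by omega
  simp [this]

lemma hh_contDiff {l : ℝ} (hl : 14 ≤ l) (n : ℕ) :
    ContDiff ℝ n (hh l (n+1)) ∧ ∀ x ∈ ZSeq.Sing l, ∀ j ≤ n, iteratedDeriv j (hh l (n+1)) x = 0 := by
  have hL := LL_ge hl
  have key := selfsim_contDiff (l := l) (by linarith) n (hh l (n+1))
    (fun x hx => hh_contDiffAt hl (n+1) (by omega) hx) (2/l) (by positivity)
    (fun x hx => hh_scale hl _ (by omega) ((le_abs_self x).trans hx))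
    (by rw [hh_low _ (by norm_num)]; simp [HH])
  refine ⟨key.1, ?_⟩
  rintro x (rfl | rfl | ⟨k, rfl⟩) j hj
  · exact key.2 j hj
  · have : hh l (n+1) =ᶠ[nhds (LL l)] fun x => (x - LL l)^(n+1) := by
      filter_upwards [Ioi_mem_nhds (show 3 < LL l by linarith)] with y hy
      exact hh_high _ (le_of_lt hy)
    rw [this.iteratedDeriv_eq]
    exact iteratedDeriv_shift_pow _ _ _ (by omega)
  · have hp : 0 < (l^k)⁻¹ := by positivity
    have : hh l (n+1) =ᶠ[nhds ((l^k)⁻¹)] fun x => (x - (l^k)⁻¹)^(n+1) := by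
      filter_upwards [Ioo_mem_nhds (show 2/3 * (l^k)⁻¹ < (l^k)⁻¹ by linarith)
        (show (l^k)⁻¹ < 2 * (l^k)⁻¹ by linarith)] with y hy
      exact hh_near hl _ (by omega) k hy.1.le hy.2.le
    rw [this.iteratedDeriv_eq]
    exact iteratedDeriv_shift_pow _ _ _ (by omega)
end partB

section partC
noncomputable def ph (l : ℝ) (n : ℕ) (x : ℝ) : ℝ := ∫ t in (0:ℝ)..x, hh l (n+1) t


lemma hh_cont {l : ℝ} (hl : 14 ≤ l) (n : ℕ) : Continuous (hh l (n+1)) := (hh_contDiff hl n).1.continuous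

lemma ph_hasDerivAt {l : ℝ} (hl : 14 ≤ l) (n : ℕ) (x : ℝ) : HasDerivAt (ph l n) (hh l (n+1) x) x :=
  intervalIntegral.integral_hasDerivAt_right ((hh_cont hl n).intervalIntegrable _ _)
    ((hh_cont hl n).stronglyMeasurableAtFilter _ _) (hh_cont hl n).continuousAt

lemma ph_deriv {l : ℝ} (hl : 14 ≤ l) (n : ℕ) : deriv (ph l n) = hh l (n+1) := funext fun x => (ph_hasDerivAt hl n x).deriv

lemma ph_contDiff {l : ℝ} (hl : 14 ≤ l) (n : ℕ) : ContDiff ℝ (n+1 : ℕ) (ph l n) := by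
  have := (contDiff_succ_iff_deriv (𝕜 := ℝ) (n := (n : WithTop ℕ∞)) (f := ph l n)).2
    ⟨fun x => (ph_hasDerivAt hl n x).differentiableAt, by simp, by
      rw [ph_deriv hl]; exact (hh_contDiff hl n).1⟩
  exact_mod_cast this

lemma ph_iter {l : ℝ} (hl : 14 ≤ l) (n : ℕ) {x : ℝ} (hx : x ∈ ZSeq.Sing l) (j : ℕ) (h1 : 1 ≤ j) (h2 : j ≤ n + 1) :
    iteratedDeriv j (ph l n) x = 0 := by
  obtain ⟨j, rfl⟩ : ∃ i, j = i + 1 := ⟨j - 1, by omega⟩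
  rw [iteratedDeriv_succ', ph_deriv hl]
  exact (hh_contDiff hl n).2 x hx j (by omega)

lemma ph_cont {l : ℝ} (hl : 14 ≤ l) (n : ℕ) : Continuous (ph l n) := (ph_contDiff hl n).continuous

lemma ph_sub {l : ℝ} (hl : 14 ≤ l) (n : ℕ) (a x : ℝ) : ph l n x - ph l n a = ∫ t in a..x, hh l (n+1) t :=
  intervalIntegral.integral_interval_sub_left ((hh_cont hl n).intervalIntegrable _ _)
    ((hh_cont hl n).intervalIntegrable _ _)

lemma ph_strictMono {l : ℝ} (hl : 14 ≤ l) (n : ℕ) (hn : Even (n+1)) : StrictMono (ph l n) := by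
  have hm : Monotone (ph l n) := by
    apply monotone_of_deriv_nonneg (fun x => (ph_hasDerivAt hl n x).differentiableAt)
    intro x; rw [ph_deriv hl]; exact hh_nonneg hl _ hn x
  intro x y hxy
  refine lt_of_le_of_ne (hm hxy.le) fun he => ?_
  obtain ⟨z, hz1, hz2⟩ := ((Sing_countable l).dense_compl ℝ).exists_between hxy
  have hc : ph l n =ᶠ[nhds z] fun _ => ph l n x := by
    filter_upwards [Ioo_mem_nhds hz2.1 hz2.2] with u hu
    exact le_antisymm ((hm hu.2.le).trans he.ge) (hm hu.1.le)
  have := hc.deriv_eq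
  rw [ph_deriv hl, deriv_const] at this
  exact hz1 (hh_zero hl _ hn (by omega) this)

lemma ph_scale {l : ℝ} (hl : 14 ≤ l) (n : ℕ) {x : ℝ} (hx : x ≤ 2 / l) : ph l n (l * x) = l^(n+2) * ph l n x := by
  unfold ph
  have := intervalIntegral.mul_integral_comp_mul_left (a := 0) (b := x) (f := hh l (n+1)) l
  rw [mul_zero] at this
  rw [← this, intervalIntegral.integral_congr (g := fun t => l^(n+1) * hh l (n+1) t)]
  · rw [intervalIntegral.integral_const_mul]; ring
  · intro t ht
    have h2 : 0 < 2 / l := by positivity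
    have : t ≤ 2 / l := by
      rcases mem_uIcc.1 ht with h | h
      · linarith [h.2]
      · linarith [h.2]
    exact hh_scale hl _ (by omega) this

lemma ph_local {l : ℝ} (hl : 14 ≤ l) (n : ℕ) {a x : ℝ} (h : ∀ t ∈ uIcc a x, hh l (n+1) t = (t - a)^(n+1)) :
    ph l n x = ph l n a + (x - a)^(n+2) / (n+2) := by
  have := ph_sub hl n a x
  rw [intervalIntegral.integral_congr (g := fun t => (t-a)^(n+1)) h,
    intervalIntegral.integral_comp_sub_right (fun t => t^(n+1)) a, integral_pow] at this
  rw [sub_self, zero_pow (by omega), sub_zero] at this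
  push_cast at this
  have e : (n:ℝ) + 1 + 1 = n + 2 := by ring
  rw [e] at this
  linarith

lemma ph_at_one {l : ℝ} (hl : 14 ≤ l) (n : ℕ) {x : ℝ} (h1 : 2/3 ≤ x) (h2 : x ≤ 2) :
    ph l n x = ph l n 1 + (x - 1)^(n+2) / (n+2) := by
  apply ph_local hl
  intro t ht
  have : 2/3 ≤ t ∧ t ≤ 2 := by
    rcases mem_uIcc.1 ht with h | h <;> constructor <;> linarith [h.1, h.2]
  rw [hh_low _ this.2, HH_one hl _ (by omega) this.1 this.2]

lemma ph_at_L {l : ℝ} (hl : 14 ≤ l) (n : ℕ) {x : ℝ} (h1 : 3 ≤ x) :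
    ph l n x = ph l n (LL l) + (x - LL l)^(n+2) / (n+2) := by
  have hL := LL_ge hl
  apply ph_local hl
  intro t ht
  have : 3 ≤ t := by
    rcases mem_uIcc.1 ht with h | h <;> linarith [h.1, h.2]
  exact hh_high _ this

lemma ph_zero {l : ℝ} (n : ℕ) : ph l n 0 = 0 := by simp [ph]

lemma ph_at_neg {l : ℝ} (hl : 14 ≤ l) (n : ℕ) {x : ℝ} (h1 : x ≤ 0) : ph l n x = x^(n+2) / (n+2) := by
  have := ph_local hl n (a := 0) (x := x) ?_
  · simpa [ph_zero] using this
  · intro t ht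
    have : t ≤ 0 := by
      rcases mem_uIcc.1 ht with h | h <;> linarith [h.1, h.2]
    rw [hh_low _ (by linarith)]
    simp [HH, this]

lemma ph_surj {l : ℝ} (hl : 14 ≤ l) (n : ℕ) (hn : Even (n+1)) : Function.Surjective (ph l n) := by
  have hodd : Odd (n+2) := hn.add_one
  apply (ph_cont hl n).surjective
  · have h1 : Tendsto (fun x : ℝ => ph l n (LL l) + (x - LL l)^(n+2) / (n+2)) atTop atTop := by
      apply tendsto_atTop_add_const_left
      apply Tendsto.atTop_div_const (by positivity)
      apply (tendsto_pow_atTop (by omega)).comp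
      exact tendsto_atTop_add_const_right _ _ tendsto_id
    apply h1.congr'
    filter_upwards [eventually_ge_atTop 3] with x hx
    exact (ph_at_L hl n hx).symm
  · have h1 : Tendsto (fun x : ℝ => x^(n+2) / (n+2)) atBot atBot := by
      apply Tendsto.atBot_div_const (by positivity)
      have : (fun x : ℝ => x^(n+2)) = fun x => -(-x)^(n+2) := by
        ext x; rw [hodd.neg_pow]; ring
      rw [this]
      exact tendsto_neg_atTop_atBot.comp
        ((tendsto_pow_atTop (by omega)).comp tendsto_neg_atBot_atTop)
    apply h1.congr'
    filter_upwards [eventually_le_atBot 0] with x hx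
    exact (ph_at_neg hl n hx).symm

/-- Chain lemma for piecewise affine inner maps. -/
lemma comp_contDiff_aux {g : ℝ → ℝ} {K : NNReal} (hg : LipschitzWith K g) (S : Set ℝ)
    (hd : ∀ x, (∃ a b, g =ᶠ[nhds x] fun y => a * y + b) ∨ g x ∈ S) (r : ℕ) :
    ∀ (ψ : ℝ → ℝ) (i : ℕ), ContDiff ℝ r ψ →
      (∀ x ∈ S, ∀ j, 1 ≤ j → j ≤ r → iteratedDeriv j ψ x = 0) →
      (i = 0 ∨ ∀ x ∈ S, ψ x = 0) →
      ContDiff ℝ r (fun x => ψ (g x) * (deriv g x)^i) := by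
  have hK : ∀ y, |deriv g y| ≤ K := fun y => norm_deriv_le_of_lipschitz hg
  have hreg : ∀ x, (∃ a b, g =ᶠ[nhds x] fun y => a * y + b) → ∃ a b, g =ᶠ[nhds x] (fun y => a * y + b) ∧
      deriv g =ᶠ[nhds x] fun _ => a := by
    rintro x ⟨a, b, h⟩
    refine ⟨a, b, h, ?_⟩
    have := h.deriv
    refine this.trans (Eventually.of_forall fun y => ?_)
    simp
  induction r with
  | zero =>
    intro ψ i hψ _ hi
    simp only [Nat.cast_zero, contDiff_zero] at *
    rw [continuous_iff_continuousAt]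
    intro x
    rcases hi with rfl | hi
    · simp only [pow_zero, mul_one]
      exact (hψ.comp hg.continuous).continuousAt
    rcases hd x with h | h
    · obtain ⟨a, b, h1, h2⟩ := hreg x h
      have : (fun x => ψ (g x) * (deriv g x)^i) =ᶠ[nhds x] fun y => ψ (g y) * a^i := by
        filter_upwards [h2] with y hy
        rw [hy]
      exact ContinuousAt.congr (((hψ.comp hg.continuous).mul continuous_const).continuousAt) this.symm
    · rw [ContinuousAt, hi _ h, zero_mul]
      refine squeeze_zero_norm (a := fun y => |ψ (g y)| * K^i) ?_ ?_
      · intro y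
        rw [norm_mul, norm_pow]
        gcongr
        · exact le_rfl
        · exact hK y
      · have : Continuous fun y => |ψ (g y)| * (K:ℝ)^i :=
          ((hψ.comp hg.continuous).abs).mul continuous_const
        have := this.tendsto x
        simpa [hi _ h] using this
  | succ r ih =>
    intro ψ i hψ hz hi
    have hψd : Differentiable ℝ ψ := hψ.differentiable (by simp)
    have hder : ∀ x, HasDerivAt (fun x => ψ (g x) * (deriv g x)^i)
        (deriv ψ (g x) * (deriv g x)^(i+1)) x := by
      intro x
      rcases hd x with h | h
      · obtain ⟨a, b, h1, h2⟩ := hreg x h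
        have e : (fun x => ψ (g x) * (deriv g x)^i) =ᶠ[nhds x] fun y => ψ (a * y + b) * a^i := by
          filter_upwards [h1, h2] with y hy1 hy2
          rw [hy1, hy2]
        refine HasDerivAt.congr_of_eventuallyEq ?_ e
        rw [h2.eq_of_nhds, h1.eq_of_nhds]
        have h3 : HasDerivAt (fun y => a * y + b) a x := by
          simpa using ((hasDerivAt_id x).const_mul a).add_const b
        have h4 := ((hψd (a * x + b)).hasDerivAt.comp x h3).mul_const (a^i)
        refine HasDerivAt.congr_deriv h4 ?_
        ring
      · have hz1 : deriv ψ (g x) = 0 := by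
          have := hz _ h 1 le_rfl (by omega)
          rwa [iteratedDeriv_one] at this
        rw [hz1, zero_mul]
        have h0 : HasDerivAt ψ 0 (g x) := hz1 ▸ (hψd (g x)).hasDerivAt
        rw [hasDerivAt_iff_isLittleO] at h0 ⊢
        simp only [smul_zero, sub_zero] at h0 ⊢
        have h1 := h0.comp_tendsto (hg.continuous.tendsto x)
        have h2 : ((fun y => y - g x) ∘ g) =O[nhds x] fun y => y - x := by
          apply Asymptotics.IsBigO.of_bound K
          filter_upwards with y
          simpa [Real.dist_eq] using hg.dist_le_mul y x
        have h3 := h1.trans_isBigO h2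
        rcases hi with rfl | hi
        · simpa [Function.comp_def] using h3
        · simp only [hi _ h, zero_mul, sub_zero] at h3 ⊢
          refine Asymptotics.IsBigO.trans_isLittleO ?_ h3
          apply Asymptotics.IsBigO.of_bound ((K:ℝ)^i)
          filter_upwards with y
          rw [norm_mul, norm_pow, mul_comm]
          simp only [Function.comp_apply]
          gcongr
          exact hK y
    have key := ih (deriv ψ) (i+1) ?_ ?_ ?_
    · have := (contDiff_succ_iff_deriv (𝕜 := ℝ) (n := (r : WithTop ℕ∞))
          (f := fun x => ψ (g x) * (deriv g x)^i)).2
        ⟨fun x => (hder x).differentiableAt, by simp, by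
          rw [show deriv (fun x => ψ (g x) * (deriv g x)^i) = _ from funext fun x => (hder x).deriv]
          exact key⟩
      exact_mod_cast this
    · have : ContDiff ℝ ((r : WithTop ℕ∞) + 1) ψ := by exact_mod_cast hψ
      exact (contDiff_succ_iff_deriv.1 this).2.2
    · intro x hx j h1 h2
      rw [← iteratedDeriv_succ']
      exact hz x hx (j+1) (by omega) (by omega)
    · right
      intro x hx
      have := hz x hx 1 le_rfl (by omega)
      rwa [iteratedDeriv_one] at this

namespace ZSeq
variable {l : ℝ} (Q : ZSeq l)

lemma comp_contDiff (hl : 14 ≤ l) (n : ℕ) : ContDiff ℝ (n+1 : ℕ) (fun x => ph l n (Q.g x)) := by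
  obtain ⟨K, hK⟩ := Q.g_lip hl
  have := comp_contDiff_aux hK (Sing l) (Q.dichotomy hl) (n+1) (ph l n) 0 (ph_contDiff hl n)
    (fun x hx j h1 h2 => ph_iter hl n hx j h1 h2) (Or.inl rfl)
  simpa using this

noncomputable def Ph (hl : 14 ≤ l) (n : ℕ) (hn : Even (n+1)) : ℝ ≃o ℝ :=
  (ph_strictMono hl n hn).orderIsoOfSurjective _ (ph_surj hl n hn)

lemma Ph_apply (hl : 14 ≤ l) (n : ℕ) (hn : Even (n+1)) (x : ℝ) : Ph hl n hn x = ph l n x := rfl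

lemma F_contDiff (hl : 14 ≤ l) (n : ℕ) (hn : Even (n+1)) :
    ContDiff ℝ (n+1 : ℕ) (fun y => Ph hl n hn (Q.g ((Ph hl n hn).symm y))) := by
  set P := Ph hl n hn with hP
  have hw := ww_gt hl
  have hw2 := two_ww hl
  have hL := LL_ge hl
  have hlp : 0 < l := by linarith
  have hil : 1 / l ≤ 1/14 := one_div_le_one_div_of_le (by norm_num) hl
  have hilp : 0 < 1 / l := by positivity
  have hll : l * (1 / l) = 1 := by field_simp
  rw [contDiff_iff_contDiffAt]
  intro y
  obtain ⟨x, rfl⟩ := P.surjective y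
  have hcont : Continuous P.symm := P.symm.continuous
  have hnear : ∀ a b : ℝ, a < x → x < b → ∀ᶠ y in nhds (P x), a < P.symm y ∧ P.symm y < b := by
    intro a b ha hb
    have := hcont.tendsto (P x)
    rw [P.symm_apply_apply] at this
    exact this.eventually (Ioo_mem_nhds ha hb)
  have hlow : x < 2 / l → ContDiffAt ℝ (n+1 : ℕ) (fun y => P (Q.g (P.symm y))) (P x) := by
    intro hx
    have : (fun y => P (Q.g (P.symm y))) =ᶠ[nhds (P x)] fun y => l^(n+2) * y := by
      filter_upwards [hnear (x-1) _ (by linarith) hx] with y hy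
      have : 2 / l = 2 * (1 / l) := by ring
      rw [Q.g_first hl (by linarith), Ph_apply, ph_scale hl n hy.2.le, ← Ph_apply hl n hn,
        P.apply_symm_apply]
    exact ContDiffAt.congr_of_eventuallyEq (by fun_prop) this
  by_cases hx : hh l (n+1) x = 0
  · rcases hh_zero hl _ hn (by omega) hx with rfl | rfl | ⟨k, rfl⟩
    · exact hlow (by positivity)
    · have : (fun y => P (Q.g (P.symm y))) =ᶠ[nhds (P (LL l))]
          fun y => P (LL l) + l^(n+2) * (y - P (LL l)) := by
        filter_upwards [hnear (LL l - 1 / l) (LL l + 1) (by linarith) (by linarith)] with y hy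
        have h1 : cc l ≤ P.symm y := by unfold cc; linarith
        have h2 : P (P.symm y) = y := P.apply_symm_apply y
        rw [Ph_apply, ph_at_L hl n (by linarith : 3 ≤ P.symm y)] at h2
        rw [Q.g_L hl h1, Ph_apply, ph_at_L hl n (by nlinarith), Ph_apply]
        have h3 : y - ph l n (LL l) = (P.symm y - LL l) ^ (n + 2) / (↑n + 2) := by linarith
        rw [h3, show LL l + l * (P.symm y - LL l) - LL l = l * (P.symm y - LL l) by ring, mul_pow]
        ring
      exact ContDiffAt.congr_of_eventuallyEq (by fun_prop) this
    · cases k with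
      | succ k =>
        apply hlow
        have : (l^(k+1))⁻¹ ≤ l⁻¹ := by
          apply inv_anti₀ hlp
          exact le_self_pow₀ (by linarith) (by omega)
        rw [div_eq_mul_inv]
        have : 0 < l⁻¹ := by positivity
        linarith
      | zero =>
        simp only [pow_zero, inv_one] at *
        have : (fun y => P (Q.g (P.symm y))) =ᶠ[nhds (P 1)]
            fun y => P 1 + l^(n+2) * (y - P 1) := by
          filter_upwards [hnear (1 - 1 / l * (1/3)) (1 + 1 / l) (by linarith) (by linarith)] with y hy
          have h2 : P (P.symm y) = y := P.apply_symm_apply y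
          rw [Ph_apply, ph_at_one hl n (by linarith : 2/3 ≤ P.symm y) (by linarith)] at h2
          rw [Q.g_third hl (by linarith) (by linarith), Ph_apply,
            ph_at_one hl n (by nlinarith) (by nlinarith), Ph_apply]
          have h3 : y - ph l n 1 = (P.symm y - 1) ^ (n + 2) / (↑n + 2) := by linarith
          rw [h3, show 1 + l * (P.symm y - 1) - 1 = l * (P.symm y - 1) by ring, mul_pow]
          ring
        exact ContDiffAt.congr_of_eventuallyEq (by fun_prop) this
  · have h1 : ContDiffAt ℝ (n+1 : ℕ) P.symm (P x) := by
      have := (P.toHomeomorph.toOpenPartialHomeomorph).contDiffAt_symm_deriv (n := (n+1 : ℕ)) (a := P x) hx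
        (by simp) (by
          change HasDerivAt (ph l n) _ (P.symm (P x))
          rw [P.symm_apply_apply]
          exact ph_hasDerivAt hl n x) (by
          change ContDiffAt ℝ _ (ph l n) (P.symm (P x))
          exact (ph_contDiff hl n).contDiffAt)
      exact this
    exact (Q.comp_contDiff hl n).contDiffAt.comp (P x) h1

end ZSeq
end partC

section partD
namespace ZSeq
variable {l : ℝ} (Q : ZSeq l)

/-- affine inverse branch of `g^n` on `D` with values in `C`. -/
def Br (D C : Set ℝ) (n : ℕ) (p s : ℝ) : Prop :=
  |s| = 1 ∧ ∀ u ∈ D, p + s * (l^n)⁻¹ * u ∈ C ∧ Q.g^[n] (p + s * (l^n)⁻¹ * u) = u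

lemma Br.comp {Q : ZSeq l} {E D C : Set ℝ} {n m : ℕ} {p s p' s' : ℝ} (h : Q.Br D C n p s)
    (h' : Q.Br E D m p' s') : Q.Br E C (m+n) (p + s * (l^n)⁻¹ * p') (s * s') := by
  refine ⟨by rw [abs_mul, h.1, h'.1, mul_one], fun u hu => ?_⟩
  have e : p + s * (l^n)⁻¹ * p' + s * s' * (l^(m+n))⁻¹ * u
      = p + s * (l^n)⁻¹ * (p' + s' * (l^m)⁻¹ * u) := by
    rw [pow_add, mul_inv]; ring
  obtain ⟨h1, h2⟩ := h'.2 u hu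
  obtain ⟨h3, h4⟩ := h.2 _ h1
  rw [e, Function.iterate_add_apply, h4]
  exact ⟨h3, h2⟩

lemma Br.mono {Q : ZSeq l} {D C C' : Set ℝ} {n : ℕ} {p s : ℝ} (h : Q.Br D C n p s) (hc : C ⊆ C') :
    Q.Br D C' n p s := ⟨h.1, fun u hu => ⟨hc (h.2 u hu).1, (h.2 u hu).2⟩⟩

lemma one_branch {D C : Set ℝ} {p s : ℝ} (hs : |s| = 1)
    (h : ∀ u ∈ D, p + s * (u / l) ∈ C ∧ Q.g (p + s * (u / l)) = u) : Q.Br D C 1 p s := by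
  refine ⟨hs, fun u hu => ?_⟩
  have e : p + s * (l^1)⁻¹ * u = p + s * (u / l) := by rw [pow_one]; ring
  rw [e]
  exact h u hu

lemma div_facts (hl : 14 ≤ l) {u : ℝ} (hu : u ∈ Icc 0 (LL l)) : 0 ≤ u / l ∧ u / l ≤ ww l ∧ l * (u / l) = u := by
  have hlp : 0 < l := by linarith
  refine ⟨div_nonneg hu.1 hlp.le, ?_, by field_simp⟩
  unfold ww
  gcongr
  exact hu.2

lemma br_up (hl : 14 ≤ l) (i : ℕ) (h : Q.z (i+1) - Q.z i = 2 * ww l) :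
    Q.Br (Icc 0 (LL l)) (Icc (Q.z i) (Q.z (i+1))) 1 (Q.z i) 1 := by
  apply Q.one_branch (by simp)
  intro u hu
  obtain ⟨h1, h2, h3⟩ := div_facts hl hu
  rw [one_mul]
  refine ⟨⟨by linarith, by linarith⟩, ?_⟩
  rw [Q.g_up (i := i) (by linarith) (by linarith)]
  linarith

lemma br_down (hl : 14 ≤ l) (i : ℕ) (h : Q.z (i+1) - Q.z i = 2 * ww l) :
    Q.Br (Icc 0 (LL l)) (Icc (Q.z i) (Q.z (i+1))) 1 (Q.z (i+1)) (-1) := by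
  apply Q.one_branch (by simp)
  intro u hu
  obtain ⟨h1, h2, h3⟩ := div_facts hl hu
  rw [neg_one_mul]
  refine ⟨⟨by linarith, by linarith⟩, ?_⟩
  rw [Q.g_down (i := i) (by linarith) (by linarith)]
  linarith

lemma br_last (hl : 14 ≤ l) :
    Q.Br (Icc 0 (LL l)) (Icc 0 (LL l)) 1 (cc l) 1 := by
  have hw := ww_gt hl
  have hc := cc_gt hl
  apply Q.one_branch (by simp)
  intro u hu
  obtain ⟨h1, h2, h3⟩ := div_facts hl hu
  rw [one_mul]
  refine ⟨⟨by linarith, by unfold cc; linarith⟩, ?_⟩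
  rw [Q.g_last (by linarith)]
  linarith

lemma br_third (hl : 14 ≤ l) :
    Q.Br (Icc 0 1) (Icc 0 1) 1 (2 * ww l) 1 := by
  have hw := ww_gt hl
  have hw2 := two_ww hl
  have hL := LL_ge hl
  apply Q.one_branch (by simp)
  intro u hu
  obtain ⟨h1, h2, h3⟩ := div_facts hl (u := u) ⟨hu.1, by linarith [hu.2]⟩
  have h4 : u / l ≤ 1 / l := by
    gcongr
    exact hu.2
  rw [one_mul]
  refine ⟨⟨by linarith, by linarith⟩, ?_⟩
  rw [Q.g_third hl (by linarith) (by linarith)]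
  have : l * (1 / l) = 1 := by field_simp
  rw [hw2]
  linarith

/-- `x` is in the image of a full branch of order `m`, with values in `C`. -/
def Full (C : Set ℝ) (m : ℕ) (x : ℝ) : Prop :=
  ∃ p s u, Q.Br (Icc 0 (LL l)) C m p s ∧ u ∈ Icc 0 (LL l) ∧ x = p + s * (l^m)⁻¹ * u

lemma full_gap (hl : 14 ≤ l) (i : ℕ) (h : Q.z (i+1) - Q.z i = 2 * ww l) {x : ℝ}
    (h1 : Q.z i ≤ x) (h2 : x ≤ Q.z (i+1)) : Q.Full (Icc (Q.z i) (Q.z (i+1))) 1 x := by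
  have hlp : 0 < l := by linarith
  have hL := ww_mul hl
  rcases le_total x (Q.z i + ww l) with h3 | h3
  · refine ⟨_, _, l * (x - Q.z i), Q.br_up hl i h, ⟨mul_nonneg hlp.le (by linarith), ?_⟩, ?_⟩
    · rw [← hL]; gcongr; linarith
    · rw [pow_one]; field_simp; ring
  · refine ⟨_, _, l * (Q.z (i+1) - x), Q.br_down hl i h, ⟨mul_nonneg hlp.le (by linarith), ?_⟩, ?_⟩
    · rw [← hL]; gcongr; linarith
    · rw [pow_one]; field_simp; ring

lemma Full.mono {Q : ZSeq l} {C C' : Set ℝ} {m : ℕ} {x : ℝ} (h : Q.Full C m x) (hc : C ⊆ C') :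
    Q.Full C' m x := by
  obtain ⟨p, s, u, h1, h2⟩ := h
  exact ⟨p, s, u, h1.mono hc, h2⟩

lemma Full.comp {Q : ZSeq l} {D C : Set ℝ} {n m : ℕ} {p s v : ℝ} (h : Q.Br D C n p s)
    (h' : Q.Full D m v) : Q.Full C (m+n) (p + s * (l^n)⁻¹ * v) := by
  obtain ⟨p', s', u, h1, h2, rfl⟩ := h'
  refine ⟨_, _, u, h.comp h1, h2, ?_⟩
  rw [pow_add, mul_inv]; ring

lemma full_Y (hl : 14 ≤ l) (n : ℕ) : ∀ v : ℝ, 0 ≤ v → v < 1 → 1 ≤ (1 - v) * l^(n+1) →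
    ∃ m, 1 ≤ m ∧ Q.Full (Icc 0 1) m v := by
  have hw2 := two_ww hl
  have hlp : 0 < l := by linarith
  have hil : 0 < 1 / l := by positivity
  have hll : l * (1 / l) = 1 := by field_simp
  have base : ∀ v : ℝ, 0 ≤ v → v ≤ 2 * ww l → ∃ m, 1 ≤ m ∧ Q.Full (Icc 0 1) m v := by
    intro v h0 h1
    have := Q.full_gap hl 0 (by rw [Q.z0, Q.z1]; ring) (x := v) (by rw [Q.z0]; exact h0) (by rw [Q.z1]; exact h1)
    refine ⟨1, le_rfl, this.mono ?_⟩
    rw [Q.z0, Q.z1]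
    exact Icc_subset_Icc le_rfl (by linarith)
  induction n with
  | zero =>
    intro v h0 h1 h
    apply base v h0
    rw [zero_add, pow_one] at h
    rw [hw2]
    have : 1 / l ≤ 1 - v := by rw [div_le_iff₀ hlp]; exact h
    linarith
  | succ n ih =>
    intro v h0 h1 h
    by_cases hv : v ≤ 2 * ww l
    · exact base v h0 hv
    push Not at hv
    obtain ⟨m, hm, hF⟩ := ih (1 + l * (v - 1)) (by nlinarith) (by nlinarith) (by
      calc 1 ≤ _ := h
        _ = _ := by ring)
    refine ⟨m + 1, by omega, ?_⟩
    have := Full.comp (Q.br_third hl) hF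
    convert this using 1
    rw [hw2]; field_simp; ring

lemma full_Y' (hl : 14 ≤ l) {v : ℝ} (h0 : 0 ≤ v) (h1 : v < 1) :
    ∃ m, 1 ≤ m ∧ Q.Full (Icc 0 1) m v := by
  obtain ⟨n, hn⟩ := pow_unbounded_of_one_lt (1 / (1 - v)) (by linarith : 1 < l)
  apply Q.full_Y hl n v h0 h1
  rw [div_lt_iff₀ (by linarith)] at hn
  have : l^n ≤ l^(n+1) := pow_le_pow_right₀ (by linarith) (by omega)
  nlinarith

lemma iter_small (hl : 14 ≤ l) (k : ℕ) : ∀ v, 0 ≤ v → v ≤ 1 → Q.g^[k] ((l^k)⁻¹ * v) = v := by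
  have hlp : 0 < l := by linarith
  have hw := ww_gt hl
  induction k with
  | zero => intro v _ _; simp
  | succ k ih =>
    intro v h0 h1
    rw [Function.iterate_succ_apply, Q.g_first hl]
    · have : l * ((l^(k+1))⁻¹ * v) = (l^k)⁻¹ * v := by
        rw [pow_succ]; field_simp
      rw [this, ih v h0 h1]
    · have h1' : (l^(k+1))⁻¹ ≤ l⁻¹ := by
        apply inv_anti₀ (by linarith)
        exact le_self_pow₀ (by linarith) (by omega)
      have h2 : l⁻¹ ≤ 14⁻¹ := inv_anti₀ (by norm_num) hl
      have h3 : 0 < (l^(k+1))⁻¹ := by positivity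
      nlinarith

lemma br_small_up (hl : 14 ≤ l) (i k : ℕ) (h : Q.z (i+1) - Q.z i = 2 * (l^(k+1))⁻¹) :
    Q.Br (Icc 0 1) (Icc (Q.z i) (Q.z (i+1))) (k+1) (Q.z i) 1 := by
  have hlp : 0 < l := by linarith
  refine ⟨by simp, fun u hu => ?_⟩
  have h3 : 0 < (l^(k+1))⁻¹ := by positivity
  have h4 : 0 ≤ (l^(k+1))⁻¹ * u := mul_nonneg h3.le hu.1
  have h5 : (l^(k+1))⁻¹ * u ≤ (l^(k+1))⁻¹ := mul_le_of_le_one_right h3.le hu.2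
  rw [one_mul]
  refine ⟨⟨by linarith, by linarith⟩, ?_⟩
  rw [Function.iterate_succ_apply, Q.g_up (i := i) (by linarith) (by linarith)]
  have : l * (Q.z i + (l ^ (k + 1))⁻¹ * u - Q.z i) = (l^k)⁻¹ * u := by
    rw [pow_succ]; field_simp; ring
  rw [this, Q.iter_small hl k u hu.1 hu.2]

lemma br_small_down (hl : 14 ≤ l) (i k : ℕ) (h : Q.z (i+1) - Q.z i = 2 * (l^(k+1))⁻¹) :
    Q.Br (Icc 0 1) (Icc (Q.z i) (Q.z (i+1))) (k+1) (Q.z (i+1)) (-1) := by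
  have hlp : 0 < l := by linarith
  refine ⟨by simp, fun u hu => ?_⟩
  have h3 : 0 < (l^(k+1))⁻¹ := by positivity
  have h4 : 0 ≤ (l^(k+1))⁻¹ * u := mul_nonneg h3.le hu.1
  have h5 : (l^(k+1))⁻¹ * u ≤ (l^(k+1))⁻¹ := mul_le_of_le_one_right h3.le hu.2
  rw [show Q.z (i+1) + -1 * (l^(k+1))⁻¹ * u = Q.z (i+1) - (l^(k+1))⁻¹ * u by ring]
  refine ⟨⟨by linarith, by linarith⟩, ?_⟩
  rw [Function.iterate_succ_apply, Q.g_down (i := i) (by linarith) (by linarith)]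
  have : l * (Q.z (i+1) - (Q.z (i+1) - (l ^ (k + 1))⁻¹ * u)) = (l^k)⁻¹ * u := by
    rw [pow_succ]; field_simp; ring
  rw [this, Q.iter_small hl k u hu.1 hu.2]

/-- midpoints of the gaps -/
def Pk : Set ℝ := range fun i => (Q.z i + Q.z (i+1))/2

lemma full_step (hl : 14 ≤ l) {x : ℝ} (hx : x ∈ Icc 0 (LL l)) (hp : x ∉ Q.Pk) :
    ∃ m, 1 ≤ m ∧ Q.Full (Icc 0 (LL l)) m x := by
  have hlp : 0 < l := by linarith
  have hw := ww_gt hl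
  have hL := ww_mul hl
  rcases lt_or_ge x (cc l) with h | h
  · obtain ⟨i, h1, h2⟩ := Q.locate hx.1 h
    have hsub : Icc (Q.z i) (Q.z (i+1)) ⊆ Icc 0 (LL l) := by
      apply Icc_subset_Icc (Q.z_nonneg i)
      have := Q.z_lt (i+1)
      unfold cc at this
      linarith
    rcases Q.gap i with hg | ⟨k, hg⟩
    · exact ⟨1, le_rfl, (Q.full_gap hl i hg h1 h2.le).mono hsub⟩
    have h3 : 0 < (l^(k+1))⁻¹ := by positivity
    have h4 : 0 < l^(k+1) := by positivity
    have h5 : (l^(k+1))⁻¹ * l^(k+1) = 1 := by field_simp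
    rcases lt_trichotomy x ((Q.z i + Q.z (i+1))/2) with h' | h' | h'
    · obtain ⟨m, hm, hF⟩ := Q.full_Y' hl (v := (x - Q.z i) * l^(k+1))
        (mul_nonneg (by linarith) h4.le) (by nlinarith)
      refine ⟨m + (k+1), by omega, ?_⟩
      have := Full.comp ((Q.br_small_up hl i k hg).mono hsub) hF
      convert this using 1
      field_simp; ring
    · exact absurd ⟨i, h'.symm⟩ hp
    · obtain ⟨m, hm, hF⟩ := Q.full_Y' hl (v := (Q.z (i+1) - x) * l^(k+1))
        (mul_nonneg (by linarith) h4.le) (by nlinarith)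
      refine ⟨m + (k+1), by omega, ?_⟩
      have := Full.comp ((Q.br_small_down hl i k hg).mono hsub) hF
      convert this using 1
      field_simp; ring
  · refine ⟨1, le_rfl, _, _, l * (x - cc l), Q.br_last hl, ⟨mul_nonneg hlp.le (by linarith), ?_⟩, ?_⟩
    · rw [← hL]; gcongr; have := hx.2; unfold cc; linarith
    · rw [pow_one]; field_simp; ring

lemma countable_preimage (hl : 14 ≤ l) {C : Set ℝ} (hC : C.Countable) :
    {x | x ∈ Icc 0 (LL l) ∧ Q.g x ∈ C}.Countable := by
  have hlp : 0 < l := by linarith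
  have h1 : ((fun q : ℝ × ℝ => q.1 + q.2 / l) '' (Q.Z ×ˢ C)).Countable := (Q.countable.prod hC).image _
  have h2 : ((fun q : ℝ × ℝ => q.1 - q.2 / l) '' (Q.Z ×ˢ C)).Countable := (Q.countable.prod hC).image _
  refine (h1.union h2).mono ?_
  rintro x ⟨hx, hc⟩
  obtain ⟨z, hz, hd⟩ := Q.compact.exists_infDist_eq_dist Q.nonempty x
  have hg := Q.g_of_nonneg hx.1
  rw [hd, Real.dist_eq] at hg
  rcases le_total z x with h | h
  · left
    refine ⟨(z, Q.g x), ⟨hz, hc⟩, ?_⟩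
    simp only
    rw [hg, abs_of_nonneg (by linarith)]; field_simp; ring
  · right
    refine ⟨(z, Q.g x), ⟨hz, hc⟩, ?_⟩
    simp only
    rw [hg, abs_of_nonpos (by linarith)]; field_simp; ring

def Bad : Set ℝ := {x | x ∈ Icc 0 (LL l) ∧ ∃ n, Q.g^[n] x ∈ Q.Pk}

lemma bad_countable (hl : 14 ≤ l) : Q.Bad.Countable := by
  have : Q.Bad = ⋃ n, {x | x ∈ Icc 0 (LL l) ∧ Q.g^[n] x ∈ Q.Pk} := by
    ext x; simp only [Bad, mem_ofPred_eq, mem_iUnion]; tauto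
  rw [this]
  apply countable_iUnion
  intro n
  induction n with
  | zero => exact (countable_range _).mono fun x hx => hx.2
  | succ n ih =>
    refine (Q.countable_preimage hl ih).mono ?_
    rintro x ⟨hx, h⟩
    exact ⟨hx, Q.mapsTo hl hx, h⟩

lemma full_infinite (hl : 14 ≤ l) {x : ℝ} (hx : x ∈ Icc 0 (LL l)) (hp : x ∉ Q.Bad) (j : ℕ) :
    ∃ m, j ≤ m ∧ Q.Full (Icc 0 (LL l)) m x := by
  induction j with
  | zero =>
    refine ⟨0, le_rfl, 0, 1, x, ⟨by simp, fun u hu => ?_⟩, hx, by simp⟩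
    simpa using hu
  | succ j ih =>
    obtain ⟨m, hm, p, s, u, h1, h2, h3⟩ := ih
    have hu : Q.g^[m] x = u := by rw [h3]; exact (h1.2 u h2).2
    obtain ⟨m', hm', hF⟩ := Q.full_step hl h2 (by
      intro hc
      exact hp ⟨hx, m, by rwa [hu]⟩)
    refine ⟨m' + m, by omega, ?_⟩
    rw [h3]
    exact Full.comp h1 hF

end ZSeq
end partD

section partE
open MeasureTheory

lemma choose_sep (S : Set ℝ) (d : ℝ) (hd : 0 < d) (M : ℕ) (h : ENNReal.ofReal (M * (6 * d)) < volume S) :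
    ∃ E : Finset ℝ, ↑E ⊆ S ∧ E.card = M + 1 ∧ ∀ x ∈ E, ∀ y ∈ E, x ≠ y → 3 * d < |x - y| := by
  have key : ∀ E : Finset ℝ, E.card ≤ M → ∃ y ∈ S, ∀ x ∈ E, 3 * d < |y - x| := by
    intro E hE
    by_contra hcon
    push Not at hcon
    have hsub : S ⊆ ⋃ x ∈ E, Metric.closedBall x (3 * d) := by
      intro y hy
      obtain ⟨x, hx, hxy⟩ := hcon y hy
      simp only [mem_iUnion]
      exact ⟨x, hx, by rwa [Metric.mem_closedBall, Real.dist_eq]⟩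
    have : volume S ≤ ENNReal.ofReal (M * (6 * d)) := by
      calc volume S ≤ volume (⋃ x ∈ E, Metric.closedBall x (3 * d)) := measure_mono hsub
        _ ≤ ∑ x ∈ E, volume (Metric.closedBall x (3 * d)) := measure_biUnion_finset_le _ _
        _ = E.card * ENNReal.ofReal (6 * d) := by
          simp only [Real.volume_closedBall, Finset.sum_const, nsmul_eq_mul]
          congr 2; ring
        _ ≤ M * ENNReal.ofReal (6 * d) := by gcongr
        _ = _ := by
          rw [ENNReal.ofReal_mul (p := (M : ℝ)) (by positivity), ENNReal.ofReal_natCast]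
    exact absurd h (not_lt.2 this)
  have : ∀ j ≤ M + 1, ∃ E : Finset ℝ, ↑E ⊆ S ∧ E.card = j ∧ ∀ x ∈ E, ∀ y ∈ E, x ≠ y → 3 * d < |x - y| := by
    intro j
    induction j with
    | zero => intro _; exact ⟨∅, by simp, rfl, by simp⟩
    | succ j ih =>
      intro hj
      obtain ⟨E, h1, h2, h3⟩ := ih (by omega)
      obtain ⟨y, hy, hy'⟩ := key E (by omega)
      have hyE : y ∉ E := by
        intro hc
        have := hy' y hc
        simp at this; linarith
      refine ⟨insert y E, ?_, ?_, ?_⟩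
      · rw [Finset.coe_insert]; exact insert_subset hy h1
      · rw [Finset.card_insert_of_notMem hyE, h2]
      · intro a ha b hb hab
        rw [Finset.mem_insert] at ha hb
        rcases ha with rfl | ha
        · rcases hb with rfl | hb
          · exact absurd rfl hab
          · exact hy' b hb
        · rcases hb with rfl | hb
          · rw [abs_sub_comm]; exact hy' a ha
          · exact h3 a ha b hb hab
  exact this _ le_rfl

namespace ZSeq
variable {l : ℝ} (Q : ZSeq l)

def SS (n : ℕ) : Set ℝ := {x | Q.Full (Icc 0 (LL l)) n x}

lemma vol_good (hl : 14 ≤ l) : volume (Icc 0 (LL l) \ Q.Bad) ≠ 0 := by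
  rw [measure_sdiff_null ((Q.bad_countable hl).measure_zero _), Real.volume_Icc]
  have := LL_ge hl
  simp; linarith

lemma large_vol (hl : 14 ≤ l) {q : ℝ} (h0 : 0 < q) (h1 : q < 1) (N : ℕ) :
    ∃ n ≥ N, ENNReal.ofReal (q^n) < volume (Q.SS n) := by
  by_contra hcon
  push Not at hcon
  have hz : volume (limsup (fun n => Q.SS (n + N)) atTop) = 0 := by
    apply measure_limsup_atTop_eq_zero
    have : ∑' n, volume (Q.SS (n + N)) ≤ ∑' n, ENNReal.ofReal (q^n) := by
      apply ENNReal.tsum_le_tsum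
      intro n
      refine (hcon (n+N) (by omega)).trans (ENNReal.ofReal_le_ofReal ?_)
      exact pow_le_pow_of_le_one h0.le h1.le (by omega)
    refine ne_top_of_le_ne_top ?_ this
    exact (summable_geometric_of_lt_one h0.le h1).tsum_ofReal_ne_top
  apply Q.vol_good hl
  refine measure_mono_null ?_ hz
  intro x hx
  rw [mem_limsup_iff_frequently_mem, Filter.frequently_atTop]
  intro a
  obtain ⟨m, hm, hF⟩ := Q.full_infinite hl hx.1 hx.2 (a + N)
  refine ⟨m - N, by omega, ?_⟩
  rw [Nat.sub_add_cancel (by omega)]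
  exact hF

lemma leo (hl : 14 ≤ l) {U : Set ℝ} (hU : IsOpen U) (hne : (U ∩ Icc 0 (LL l)).Nonempty) :
    ∃ n, Icc 0 (LL l) ⊆ Q.g^[n] '' (U ∩ Icc 0 (LL l)) := by
  have hlp : 0 < l := by linarith
  have hL := LL_ge hl
  have : ∃ x ∈ U ∩ Icc 0 (LL l), x ∉ Q.Bad := by
    by_contra hcon
    push Not at hcon
    have hsub : U ∩ Icc 0 (LL l) ⊆ Q.Bad := hcon
    have h0 := (Q.bad_countable hl).mono hsub
    obtain ⟨x, hxU, hx⟩ := hne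
    have hcl : x ∈ closure (Ioo 0 (LL l)) := by
      rw [closure_Ioo (by linarith)]; exact hx
    obtain ⟨y, hyU, hy⟩ := mem_closure_iff.1 hcl U hU hxU
    have hopen : IsOpen (U ∩ Ioo 0 (LL l)) := hU.inter isOpen_Ioo
    have h1 := hopen.measure_pos volume ⟨y, hyU, hy⟩
    have h2 := (h0.mono (inter_subset_inter_right U Ioo_subset_Icc_self)).measure_zero volume
    exact h1.ne' h2
  obtain ⟨x, ⟨hxU, hx⟩, hxb⟩ := this
  obtain ⟨ε, hε, hball⟩ := Metric.isOpen_iff.1 hU x hxU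
  obtain ⟨j, hj⟩ := exists_pow_lt_of_lt_one (show 0 < ε / LL l by positivity) (inv_lt_one_of_one_lt₀ (by linarith : 1 < l))
  obtain ⟨m, hm, p, s, u, h1, h2, h3⟩ := Q.full_infinite hl hx hxb j
  refine ⟨m, fun v hv => ⟨p + s * (l^m)⁻¹ * v, ⟨hball ?_, (h1.2 v hv).1⟩, (h1.2 v hv).2⟩⟩
  rw [Metric.mem_ball, Real.dist_eq, h3]
  have e : p + s * (l ^ m)⁻¹ * v - (p + s * (l ^ m)⁻¹ * u) = s * ((l^m)⁻¹ * (v - u)) := by ring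
  rw [e, abs_mul, h1.1, one_mul, abs_mul, abs_of_pos (by positivity)]
  have h4 : |v - u| ≤ LL l := abs_le.2 ⟨by linarith [hv.1, h2.2], by linarith [hv.2, h2.1]⟩
  have h5 : (l^m)⁻¹ ≤ (l⁻¹)^j := by
    rw [← inv_pow]
    exact pow_le_pow_of_le_one (by positivity) (inv_le_one_of_one_le₀ (by linarith)) hm
  calc (l^m)⁻¹ * |v - u| ≤ (l⁻¹)^j * LL l := by gcongr
    _ < ε / LL l * LL l := by gcongr
    _ = ε := by field_simp

lemma surj (hl : 14 ≤ l) {v : ℝ} (hv : v ∈ Icc 0 (LL l)) (n : ℕ) :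
    ∃ x ∈ Icc 0 (LL l), Q.g^[n] x = v := by
  induction n with
  | zero => exact ⟨v, hv, rfl⟩
  | succ n ih =>
    obtain ⟨x, hx, he⟩ := ih
    obtain ⟨h1, h2⟩ := (Q.br_last hl).2 x hx
    refine ⟨_, h1, ?_⟩
    rw [Nat.add_comm, Nat.add_comm 1 n, Function.iterate_succ_apply]
    rw [Function.iterate_one] at h2
    rw [h2, he]

lemma iter_mapsTo (hl : 14 ≤ l) (n : ℕ) : MapsTo Q.g^[n] (Icc 0 (LL l)) (Icc 0 (LL l)) :=
  (Q.mapsTo hl).iterate n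

/-- separated set -/
def Sep (g : ℝ → ℝ) (n : ℕ) (ε : ℝ) (E : Finset ℝ) : Prop :=
  ∀ x ∈ E, ∀ y ∈ E, x ≠ y → ∃ k < n, ε < |g^[k] x - g^[k] y|

lemma horseshoe (hl : 14 ≤ l) {n : ℕ} (hn : 1 ≤ n) {d : ℝ} (hd : d = LL l * (l^n)⁻¹) (E : Finset ℝ)
    (hE : ↑E ⊆ Q.SS n) (hsep : ∀ x ∈ E, ∀ y ∈ E, x ≠ y → 3 * d < |x - y|) (j : ℕ) :
    ∃ W : Finset ℝ, ↑W ⊆ Icc 0 (LL l) ∧ W.card = E.card^j ∧ Sep Q.g (n*j) d W := by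
  classical
  have hlp : 0 < l := by linarith
  have hL := LL_ge hl
  have : ∀ x, ∃ p s, x ∈ E → Q.Br (Icc 0 (LL l)) (Icc 0 (LL l)) n p s ∧ ∃ u ∈ Icc 0 (LL l), x = p + s * (l^n)⁻¹ * u := by
    intro x
    by_cases hx : x ∈ E
    · obtain ⟨p, s, u, h1, h2, h3⟩ := hE hx
      exact ⟨p, s, fun _ => ⟨h1, u, h2, h3⟩⟩
    · exact ⟨0, 0, fun h => absurd h hx⟩
  choose p s hps using this
  let io : ℝ → ℝ → ℝ := fun x u => p x + s x * (l^n)⁻¹ * u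
  have hio : ∀ x ∈ E, ∀ u ∈ Icc 0 (LL l), io x u ∈ Icc 0 (LL l) ∧ Q.g^[n] (io x u) = u :=
    fun x hx u hu => (hps x hx).1.2 u hu
  have hdist : ∀ x ∈ E, ∀ u ∈ Icc 0 (LL l), |io x u - x| ≤ d := by
    intro x hx u hu
    obtain ⟨h1, v, hv, h3⟩ := hps x hx
    have e : io x u - x = s x * ((l^n)⁻¹ * (u - v)) := by
      simp only [io]
      linear_combination -h3
    rw [e, abs_mul, h1.1, one_mul, abs_mul, abs_of_pos (by positivity), hd, mul_comm]
    gcongr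
    exact abs_le.2 ⟨by linarith [hu.1, hv.2], by linarith [hu.2, hv.1]⟩
  have hfar : ∀ x ∈ E, ∀ y ∈ E, x ≠ y → ∀ u ∈ Icc 0 (LL l), ∀ v ∈ Icc 0 (LL l), d < |io x u - io y v| := by
    intro x hx y hy hxy u hu v hv
    have h1 := hdist x hx u hu
    have h2 := hdist y hy v hv
    have h3 := hsep x hx y hy hxy
    have h4 : |x - y| ≤ |io x u - x| + |io x u - io y v| + |io y v - y| := by
      rw [show x - y = -(io x u - x) + (io x u - io y v) + (io y v - y) by ring]
      refine (abs_add_le _ _).trans ?_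
      gcongr
      refine (abs_add_le _ _).trans ?_
      rw [abs_neg]
    linarith
  have hdp : 0 < d := by rw [hd]; positivity
  induction j with
  | zero =>
    refine ⟨{0}, ?_, by simp, ?_⟩
    · simp; linarith
    · intro x hx y hy hxy
      rw [Finset.mem_singleton] at hx hy
      exact absurd (hx.trans hy.symm) hxy
  | succ j ih =>
    obtain ⟨W, h1, h2, h3⟩ := ih
    refine ⟨(E ×ˢ W).image fun q => io q.1 q.2, ?_, ?_, ?_⟩
    · intro a ha
      rw [Finset.mem_coe, Finset.mem_image] at ha
      obtain ⟨⟨x, u⟩, hq, rfl⟩ := ha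
      rw [Finset.mem_product] at hq
      exact (hio x hq.1 u (h1 hq.2)).1
    · rw [Finset.card_image_of_injOn, Finset.card_product, h2, pow_succ, mul_comm]
      rintro ⟨x, u⟩ hq ⟨y, v⟩ hq' he
      rw [Finset.mem_coe, Finset.mem_product] at hq hq'
      simp only at hq hq' he
      have hxy : x = y := by
        by_contra hne
        have := hfar x hq.1 y hq'.1 hne u (h1 hq.2) v (h1 hq'.2)
        rw [he] at this
        simp at this
        linarith
      subst hxy
      have e1 := (hio x hq.1 u (h1 hq.2)).2
      have e2 := (hio x hq.1 v (h1 hq'.2)).2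
      rw [he, e2] at e1
      rw [e1]
    · intro a ha b hb hab
      rw [Finset.mem_image] at ha hb
      obtain ⟨⟨x, u⟩, hq, rfl⟩ := ha
      obtain ⟨⟨y, v⟩, hq', rfl⟩ := hb
      rw [Finset.mem_product] at hq hq'
      simp only at hq hq' hab ⊢
      by_cases hxy : x = y
      · subst hxy
        have huv : u ≠ v := by rintro rfl; exact hab rfl
        obtain ⟨k, hk, hk'⟩ := h3 u hq.2 v hq'.2 huv
        refine ⟨k + n, by rw [Nat.mul_succ]; omega, ?_⟩
        rw [Function.iterate_add_apply, Function.iterate_add_apply,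
          (hio x hq.1 u (h1 hq.2)).2, (hio x hq'.1 v (h1 hq'.2)).2]
        exact hk'
      · exact ⟨0, by positivity, hfar x hq.1 y hq'.1 hxy u (h1 hq.2) v (h1 hq'.2)⟩

/-- Lower bound. -/
lemma lower (hl : 14 ≤ l) {ρ : ℝ} (h0 : 0 < ρ) (h1 : ρ < l) (N : ℕ) :
    ∃ n ≥ N, ∃ M : ℕ, ρ^n / (6 * LL l) ≤ M ∧ 1 ≤ M ∧ ∃ d > 0, ∀ j, ∃ W : Finset ℝ,
      ↑W ⊆ Icc 0 (LL l) ∧ W.card = M^j ∧ Sep Q.g (n*j) d W := by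
  have hlp : 0 < l := by linarith
  have hL := LL_ge hl
  obtain ⟨n, hn, hv⟩ := Q.large_vol hl (q := ρ / l) (by positivity) (by rw [div_lt_one hlp]; exact h1) (N+1)
  set d := LL l * (l^n)⁻¹ with hd
  have hdp : 0 < d := by positivity
  obtain ⟨E, hE1, hE2, hE3⟩ := choose_sep (Q.SS n) d hdp ⌊ρ^n / (6 * LL l)⌋₊ (by
    refine lt_of_le_of_lt (ENNReal.ofReal_le_ofReal ?_) hv
    calc (⌊ρ^n / (6 * LL l)⌋₊ : ℝ) * (6 * d) ≤ ρ^n / (6 * LL l) * (6 * d) := by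
          gcongr
          exact Nat.floor_le (by positivity)
      _ = (ρ / l)^n := by
          rw [hd, div_pow]; field_simp)
  refine ⟨n, by omega, E.card, ?_, by omega, d, hdp, fun j => Q.horseshoe hl (by omega) hd E hE1 hE3 j⟩
  rw [hE2]
  push_cast
  exact (Nat.lt_floor_add_one _).le

lemma iter_lip (hl : 14 ≤ l) (k : ℕ) {x y : ℝ} (hx : x ∈ Icc 0 (LL l)) (hy : y ∈ Icc 0 (LL l)) :
    |Q.g^[k] x - Q.g^[k] y| ≤ l^k * |x - y| := by
  induction k with
  | zero => simp
  | succ k ih =>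
    rw [Function.iterate_succ_apply', Function.iterate_succ_apply']
    have := Q.g_lip_on hl (Q.iter_mapsTo hl k hx).1 (Q.iter_mapsTo hl k hy).1
    refine this.trans ?_
    rw [pow_succ, mul_comm (l^k), mul_assoc]
    have hlp : 0 < l := by linarith
    gcongr

/-- Upper bound. -/
lemma upper (hl : 14 ≤ l) {n : ℕ} {ε : ℝ} (hε : 0 < ε) {E : Finset ℝ} (hE : ↑E ⊆ Icc 0 (LL l))
    (hs : Sep Q.g n ε E) : (E.card : ℝ) ≤ (LL l / ε + 1) * l^n := by
  have hlp : 0 < l := by linarith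
  have hL := LL_ge hl
  have hfar : ∀ x ∈ E, ∀ y ∈ E, x ≠ y → ε < l^n * |x - y| := by
    intro x hx y hy hxy
    obtain ⟨k, hk, h⟩ := hs x hx y hy hxy
    refine (h.trans_le (Q.iter_lip hl k (hE hx) (hE hy))).trans_le ?_
    gcongr
    linarith
  set t := l^n / ε with ht
  have htp : 0 < t := by positivity
  have hc : E.card ≤ (Finset.range (⌊t * LL l⌋₊ + 1)).card := by
    apply Finset.card_le_card_of_injOn (fun x => ⌊t * x⌋₊)
    · intro x hx
      rw [Finset.mem_coe, Finset.mem_range, Nat.lt_succ_iff]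
      apply Nat.floor_le_floor
      gcongr
      exact (hE hx).2
    · intro x hx y hy he
      by_contra hxy
      have h1 := hfar x hx y hy hxy
      have h2 := (hE hx).1
      have h3 := (hE hy).1
      have a1 := Nat.floor_le (show 0 ≤ t * x by positivity)
      have a2 := Nat.lt_floor_add_one (t * x)
      have b1 := Nat.floor_le (show 0 ≤ t * y by positivity)
      have b2 := Nat.lt_floor_add_one (t * y)
      simp only at he
      rw [he] at a1 a2
      have h4 : |t * x - t * y| < 1 := abs_lt.2 ⟨by linarith, by linarith⟩
      rw [← mul_sub, abs_mul, abs_of_pos htp, ht, div_mul_eq_mul_div, div_lt_one hε] at h4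
      linarith
  rw [Finset.card_range] at hc
  have h5 : (E.card : ℝ) ≤ (⌊t * LL l⌋₊ : ℝ) + 1 := by exact_mod_cast hc
  have h6 := Nat.floor_le (show 0 ≤ t * LL l by positivity)
  have h7 : (1:ℝ) ≤ l^n := one_le_pow₀ (by linarith)
  calc (E.card : ℝ) ≤ t * LL l + l^n := by linarith
    _ = _ := by rw [ht]; field_simp

end ZSeq
end partE

section final
open ZSeq

variable {l : ℝ}

lemma conj_iter (g : ℝ → ℝ) (H : ℝ ≃o ℝ) (n : ℕ) (x : ℝ) :
    (fun y => H (g (H.symm y)))^[n] (H x) = H (g^[n] x) := by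
  induction n with
  | zero => rfl
  | succ n ih =>
    rw [Function.iterate_succ_apply', ih, Function.iterate_succ_apply', H.symm_apply_apply]

lemma unif (H : ℝ ≃o ℝ) (a b : ℝ) {ε : ℝ} (hε : 0 < ε) :
    ∃ η > 0, ∀ x ∈ Icc a b, ∀ y ∈ Icc a b, ε < |H x - H y| → η < |x - y| := by
  have hu : UniformContinuousOn H (Icc a b) :=
    isCompact_Icc.uniformContinuousOn_of_continuous H.continuous.continuousOn
  rw [Metric.uniformContinuousOn_iff] at hu
  obtain ⟨η, hη, h⟩ := hu ε hε
  refine ⟨η / 2, by positivity, fun x hx y hy hxy => ?_⟩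
  by_contra hcon
  push Not at hcon
  have := h x hx y hy (by rw [Real.dist_eq]; linarith)
  rw [Real.dist_eq] at this
  linarith

lemma H_maps {L : ℝ} (H : ℝ ≃o ℝ) (h0 : H 0 = 0) (hL : H L = 4) {x : ℝ} :
    H x ∈ Icc (0:ℝ) 4 ↔ x ∈ Icc 0 L := by
  rw [mem_Icc, mem_Icc]
  conv_lhs => rw [← h0, ← hL]
  rw [H.le_iff_le, H.le_iff_le]

lemma mixing_final (Q : ZSeq l) (hl : 14 ≤ l) (H : ℝ ≃o ℝ) (h0 : H 0 = 0) (hL : H (LL l) = 4) :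
    IsTopologicallyMixingOn (fun y => H (Q.g (H.symm y))) (Icc (0:ℝ) 4) := by
  rintro U V hU hV - ⟨V', hV', rfl⟩ ⟨y, hy⟩ ⟨w, hw⟩
  obtain ⟨N, hN⟩ := Q.leo hl (U := H ⁻¹' V') (hV'.preimage H.continuous) (by
    refine ⟨H.symm w, ?_, ?_⟩
    · simpa using hw.1
    · rw [← H_maps H h0 hL, H.apply_symm_apply]; exact hw.2)
  refine ⟨N, fun n hn => ?_⟩
  have hy' : H.symm y ∈ Icc 0 (LL l) := by
    rw [← H_maps H h0 hL, H.apply_symm_apply]; exact hU hy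
  obtain ⟨v, hv, hv'⟩ := Q.surj hl hy' (n - N)
  obtain ⟨x, ⟨hx1, hx2⟩, hx3⟩ := hN hv
  refine ⟨H x, ?_, hx1, (H_maps H h0 hL).2 hx2⟩
  rw [mem_preimage, conj_iter]
  have : Q.g^[n] x = H.symm y := by
    rw [← hv', ← hx3, ← Function.iterate_add_apply, Nat.sub_add_cancel hn]
  rw [this, H.apply_symm_apply]
  exact hy

lemma sep_upper (Q : ZSeq l) (hl : 14 ≤ l) (H : ℝ ≃o ℝ) (h0 : H 0 = 0) (hL : H (LL l) = 4)
    {ε : ℝ} (hε : 0 < ε) : ∃ C : ℝ, 1 ≤ C ∧ ∀ n (E : Finset ℝ), ↑E ⊆ Icc (0:ℝ) 4 →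
      Sep (fun y => H (Q.g (H.symm y))) n ε E → (E.card : ℝ) ≤ C * l^n := by
  classical
  obtain ⟨η, hη, hun⟩ := unif H 0 (LL l) hε
  have hLL := LL_ge hl
  refine ⟨LL l / η + 1, by have : 0 < LL l / η := (by positivity); linarith, fun n E hE hs => ?_⟩
  have hmem : ∀ x ∈ E, H.symm x ∈ Icc 0 (LL l) := by
    intro x hx
    rw [← H_maps H h0 hL, H.apply_symm_apply]; exact hE hx
  have hc : (E.image H.symm).card = E.card := Finset.card_image_of_injective _ H.symm.injective
  rw [← hc]
  apply Q.upper hl hη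
  · intro a ha
    rw [Finset.mem_coe, Finset.mem_image] at ha
    obtain ⟨x, hx, rfl⟩ := ha
    exact hmem x hx
  · intro a ha b hb hab
    rw [Finset.mem_image] at ha hb
    obtain ⟨x, hx, rfl⟩ := ha
    obtain ⟨y, hy, rfl⟩ := hb
    obtain ⟨k, hk, h⟩ := hs x hx y hy (by rintro rfl; exact hab rfl)
    refine ⟨k, hk, ?_⟩
    have e1 := conj_iter Q.g H k (H.symm x)
    have e2 := conj_iter Q.g H k (H.symm y)
    rw [H.apply_symm_apply] at e1 e2
    rw [e1, e2] at h
    exact hun _ (Q.iter_mapsTo hl k (hmem x hx)) _ (Q.iter_mapsTo hl k (hmem y hy)) h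

lemma sep_lower (Q : ZSeq l) (hl : 14 ≤ l) (H : ℝ ≃o ℝ) (h0 : H 0 = 0) (hL : H (LL l) = 4)
    {d : ℝ} (hd : 0 < d) : ∃ ε₀ > 0, ∀ ε < ε₀, ∀ n (W : Finset ℝ), ↑W ⊆ Icc 0 (LL l) →
      Sep Q.g n d W → ∃ E : Finset ℝ, ↑E ⊆ Icc (0:ℝ) 4 ∧ E.card = W.card ∧
        Sep (fun y => H (Q.g (H.symm y))) n ε E := by
  classical
  obtain ⟨η, hη, hun⟩ := unif H.symm 0 4 hd
  refine ⟨η, hη, fun ε hε n W hW hs => ⟨W.image H, ?_,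
    Finset.card_image_of_injective _ H.injective, ?_⟩⟩
  · intro a ha
    rw [Finset.mem_coe, Finset.mem_image] at ha
    obtain ⟨x, hx, rfl⟩ := ha
    exact (H_maps H h0 hL).2 (hW hx)
  · intro a ha b hb hab
    rw [Finset.mem_image] at ha hb
    obtain ⟨x, hx, rfl⟩ := ha
    obtain ⟨y, hy, rfl⟩ := hb
    obtain ⟨k, hk, h⟩ := hs x hx y hy (by rintro rfl; exact hab rfl)
    refine ⟨k, hk, ?_⟩
    rw [conj_iter, conj_iter]
    refine hε.trans (hun _ ((H_maps H h0 hL).2 (Q.iter_mapsTo hl k (hW hx))) _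
      ((H_maps H h0 hL).2 (Q.iter_mapsTo hl k (hW hy))) ?_)
    rw [H.symm_apply_apply, H.symm_apply_apply]
    exact h

lemma entropy_final (Q : ZSeq l) (hl : 14 ≤ l) (H : ℝ ≃o ℝ) (h0 : H 0 = 0) (hL : H (LL l) = 4) :
    Tendsto (fun ε : ℝ =>
      limsup (fun n : ℕ => Real.log (sepNum (fun y => H (Q.g (H.symm y))) (Icc (0:ℝ) 4) n ε) / (n : ℝ)) atTop)
        (nhdsWithin 0 (Ioi 0)) (nhds (Real.log l)) := by
  have hlp : 0 < l := by linarith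
  have hLL := LL_ge hl
  set f := fun y => H (Q.g (H.symm y)) with hf
  have hne : ∀ n ε, {m : ℕ | ∃ E : Finset ℝ, ↑E ⊆ Icc (0:ℝ) 4 ∧
    (∀ x ∈ E, ∀ y ∈ E, x ≠ y → ∃ k < n, ε < |f^[k] x - f^[k] y|) ∧ E.card = m}.Nonempty :=
    fun n ε => ⟨_, ∅, by simp, by simp, rfl⟩
  have hbd : ∀ n ε, 0 < ε → BddAbove {m : ℕ | ∃ E : Finset ℝ, ↑E ⊆ Icc (0:ℝ) 4 ∧
    (∀ x ∈ E, ∀ y ∈ E, x ≠ y → ∃ k < n, ε < |f^[k] x - f^[k] y|) ∧ E.card = m} := by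
    intro n ε hε
    obtain ⟨C, hC, h⟩ := sep_upper Q hl H h0 hL hε
    refine ⟨⌊C * l^n⌋₊, ?_⟩
    rintro m ⟨E, h1, h2, rfl⟩
    exact Nat.le_floor (h n E h1 h2)
  have hge : ∀ n ε, 0 < ε → ∀ E : Finset ℝ, ↑E ⊆ Icc (0:ℝ) 4 → Sep f n ε E →
      E.card ≤ sepNum f (Icc (0:ℝ) 4) n ε :=
    fun n ε hε E h1 h2 => le_csSup (hbd n ε hε) ⟨E, h1, h2, rfl⟩
  have hpos : ∀ n ε, 0 < ε → 1 ≤ sepNum f (Icc (0:ℝ) 4) n ε := by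
    intro n ε hε
    have := hge n ε hε {0} (by simp) (by
      intro x hx y hy hxy
      rw [Finset.mem_singleton] at hx hy
      exact absurd (hx.trans hy.symm) hxy)
    simpa using this
  have hup : ∀ ε, 0 < ε → ∃ C : ℝ, 1 ≤ C ∧ ∀ n, (sepNum f (Icc (0:ℝ) 4) n ε : ℝ) ≤ C * l^n := by
    intro ε hε
    obtain ⟨C, hC, h⟩ := sep_upper Q hl H h0 hL hε
    refine ⟨C, hC, fun n => ?_⟩
    obtain ⟨E, h1, h2, h3⟩ := Nat.sSup_mem (hne n ε) (hbd n ε hε)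
    have := h n E h1 h2
    rw [h3] at this
    exact this
  have hnonneg : ∀ ε, 0 < ε → ∀ n : ℕ, 0 ≤ Real.log (sepNum f (Icc (0:ℝ) 4) n ε) / (n : ℝ) := by
    intro ε hε n
    apply div_nonneg _ (Nat.cast_nonneg n)
    apply Real.log_nonneg
    exact_mod_cast hpos n ε hε
  have hlim : ∀ C : ℝ, Tendsto (fun n : ℕ => Real.log C / (n:ℝ) + Real.log l) atTop (nhds (Real.log l)) := by
    intro C
    have := (tendsto_const_div_atTop_nhds_zero_nat (Real.log C)).add_const (Real.log l)
    simpa using this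
  have hle : ∀ ε, 0 < ε → ∃ C : ℝ, (fun n : ℕ => Real.log (sepNum f (Icc (0:ℝ) 4) n ε) / (n : ℝ)) ≤ᶠ[atTop]
      fun n : ℕ => Real.log C / (n:ℝ) + Real.log l := by
    intro ε hε
    obtain ⟨C, hC, h⟩ := hup ε hε
    refine ⟨C, ?_⟩
    filter_upwards [eventually_ge_atTop 1] with n hn
    have hn' : (0:ℝ) < n := by exact_mod_cast hn
    have h1 : (0:ℝ) < sepNum f (Icc (0:ℝ) 4) n ε := by exact_mod_cast hpos n ε hε
    have h2 : Real.log (sepNum f (Icc (0:ℝ) 4) n ε) ≤ Real.log C + n * Real.log l := by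
      rw [← Real.log_pow, ← Real.log_mul (by linarith) (by positivity)]
      exact Real.log_le_log h1 (h n)
    rw [div_le_iff₀ hn', add_mul, div_mul_cancel₀ _ hn'.ne']
    linarith
  have hbb : ∀ ε, 0 < ε → IsBoundedUnder (· ≤ ·) atTop
      (fun n : ℕ => Real.log (sepNum f (Icc (0:ℝ) 4) n ε) / (n : ℝ)) := by
    intro ε hε
    obtain ⟨C, h⟩ := hle ε hε
    exact (hlim C).isBoundedUnder_le.mono_le h
  rw [tendsto_order]
  constructor
  · intro a ha
    obtain ⟨b, hab, hb⟩ := exists_between ha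
    have hρ : Real.exp b < l := by
      rw [← Real.lt_log_iff_exp_lt hlp]; exact hb
    obtain ⟨N, hN⟩ : ∃ N : ℕ, ∀ n ≥ N, a < b - Real.log (6 * LL l) / n := by
      have h1 : Tendsto (fun n : ℕ => b - Real.log (6 * LL l) / (n:ℝ)) atTop (nhds b) := by
        simpa using (tendsto_const_div_atTop_nhds_zero_nat (Real.log (6 * LL l))).const_sub b
      exact eventually_atTop.1 ((tendsto_order.1 h1).1 a hab)
    obtain ⟨n, hn, M, hM, hM1, d, hd, hW⟩ := Q.lower hl (Real.exp_pos b) hρ (N+1)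
    obtain ⟨ε₀, hε₀, hlow⟩ := sep_lower Q hl H h0 hL hd
    have hn' : (0:ℝ) < n := by
      have : 0 < n := by omega
      exact_mod_cast this
    have hlogM : b - Real.log (6 * LL l) / n ≤ Real.log M / n := by
      rw [le_div_iff₀ hn', sub_mul, div_mul_cancel₀ _ hn'.ne']
      have h1 := Real.log_le_log (by positivity) hM
      rw [Real.log_div (by positivity) (by positivity), Real.log_pow, Real.log_exp] at h1
      linarith
    filter_upwards [Ioo_mem_nhdsGT hε₀] with ε hε
    refine (hN n (by omega)).trans_le (hlogM.trans ?_)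
    apply le_limsup_of_frequently_le _ (hbb ε hε.1)
    rw [frequently_atTop]
    intro j
    refine ⟨n * (j+1), by nlinarith, ?_⟩
    obtain ⟨W, hW1, hW2, hW3⟩ := hW (j+1)
    obtain ⟨E, hE1, hE2, hE3⟩ := hlow ε hε.2 _ W hW1 hW3
    have h1 := hge _ ε hε.1 E hE1 hE3
    rw [hE2, hW2] at h1
    have h2 : ((M:ℝ)^(j+1)) ≤ sepNum f (Icc (0:ℝ) 4) (n * (j+1)) ε := by exact_mod_cast h1
    have hMp : (0:ℝ) < M := by exact_mod_cast hM1
    have h3 := Real.log_le_log (by positivity) h2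
    rw [Real.log_pow] at h3
    rw [div_le_div_iff₀ hn' (by push_cast; positivity)]
    push_cast at h3 ⊢
    nlinarith
  · intro a ha
    filter_upwards [self_mem_nhdsWithin] with ε hε
    obtain ⟨C, h⟩ := hle ε hε
    refine lt_of_le_of_lt ?_ ha
    rw [← (hlim C).limsup_eq]
    refine limsup_le_limsup h ?_ ?_
    · exact (isBoundedUnder_of ⟨0, fun n => hnonneg ε hε n⟩ : IsBoundedUnder (· ≥ ·) atTop _).isCoboundedUnder_le
    · exact (hlim C).isBoundedUnder_le

end final

/-- For every integer `r ≥ 1` and every real `λ ≥ 14`, there is a `C^r` map of `[0,4]`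
into itself which is topologically mixing and whose topological entropy
`lim_{ε→0⁺} limsup_n (1/n) log s_n(f,ε)` equals `log λ`. -/
theorem stmt_1 (r : ℕ) (hr : 1 ≤ r) (lam : ℝ) (hlam : 14 ≤ lam) :
    ∃ f : ℝ → ℝ,
      MapsTo f (Icc (0:ℝ) 4) (Icc (0:ℝ) 4) ∧
      ContDiffOn ℝ r f (Icc (0:ℝ) 4) ∧
      IsTopologicallyMixingOn f (Icc (0:ℝ) 4) ∧
      Tendsto (fun ε : ℝ =>
          limsup (fun n : ℕ => Real.log (sepNum f (Icc (0:ℝ) 4) n ε) / (n : ℝ)) atTop)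
        (nhdsWithin 0 (Ioi 0)) (nhds (Real.log lam)) := by
  obtain ⟨Q⟩ := exists_zseq hlam
  have hLL := LL_ge hlam
  have hn : Even (2 * r - 1 + 1) := ⟨r, by omega⟩
  set n := 2 * r - 1 with hn_def
  set P := ZSeq.Ph hlam n hn with hP
  have hP0 : P 0 = 0 := by rw [hP, ZSeq.Ph_apply]; simp [ph]
  have hPL : 0 < P (LL lam) := by
    have := P.strictMono (show (0:ℝ) < LL lam by linarith)
    rwa [hP0] at this
  have hk : 0 < 4 / P (LL lam) := by positivity
  set K : ℝ ≃o ℝ := OrderIso.mulLeft₀ (4 / P (LL lam)) hk with hK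
  have hKa : ∀ y, K y = 4 / P (LL lam) * y := fun y => rfl
  have hKs : ∀ y, K.symm y = (4 / P (LL lam))⁻¹ * y := fun y => rfl
  set H := P.trans K with hH
  have hH0 : H 0 = 0 := by rw [hH, OrderIso.trans_apply, hP0, hKa, mul_zero]
  have hHL : H (LL lam) = 4 := by rw [hH, OrderIso.trans_apply, hKa]; field_simp
  refine ⟨fun y => H (Q.g (H.symm y)), ?_, ?_, mixing_final Q hlam H hH0 hHL,
    entropy_final Q hlam H hH0 hHL⟩
  · intro y hy
    refine (H_maps H hH0 hHL).2 (Q.mapsTo hlam ?_)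
    rw [← H_maps H hH0 hHL, H.apply_symm_apply]; exact hy
  · apply ContDiff.contDiffOn
    have h1 := Q.F_contDiff hlam n hn
    have h2 : ContDiff ℝ (n+1 : ℕ) (fun y => (4 / P (LL lam)) *
        (fun y => P (Q.g (P.symm y))) ((4 / P (LL lam))⁻¹ * y)) :=
      contDiff_const.mul (h1.comp (contDiff_const.mul contDiff_id))
    refine ContDiff.of_le (n := (n+1 : ℕ)) h2 ?_
    exact_mod_cast (by omega : r ≤ n + 1)
end

section
/- For every integer r ≥ 1 and every real number λ ≥ 14, there exists a map f : [0,4] → [0,4] of class C^r with sup_{x ∈ [0,4]} |f'(x)| = λ^r such that for every nondegenerate closed subinterval J ⊆ [0,4] there exists an integer k ≥ 0 with f^k(J) = [0,4] (where f^k denotes the k-th iterate and f^k(J) its image). -/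
open Set

/-- Denominator of the conjugated Chebyshev map (parameter `p = s^2`). -/
noncomputable def denX (s x : ℝ) : ℝ :=
  ((2+4*s^2) - s^2*x)^2 + 2*s^2*((1+s^2)*x-(2+4*s^2))^2

/-- A Moebius conjugate of the Chebyshev map `y ↦ 2y²-1`. -/
noncomputable def mapX (s x : ℝ) : ℝ :=
  2*(2+4*s^2)*((1+s^2)*x-(2+4*s^2))^2 / denX s x

/-- Its derivative. -/
noncomputable def derX (s x : ℝ) : ℝ :=
  4*(2+4*s^2)^2*((1+s^2)*x-(2+4*s^2))*((2+4*s^2) - s^2*x) / denX s x ^ 2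

/-- The semiconjugacy with angle doubling. -/
noncomputable def phiX (s t : ℝ) : ℝ :=
  (2+4*s^2)*(1+Real.cos t)/(1+s^2*(1+Real.cos t))

lemma denX_pos (s x : ℝ) : 0 < denX s x := by
  unfold denX
  by_cases h : (2+4*s^2) - s^2*x = 0
  · have hs : s ≠ 0 := by
      rintro rfl
      norm_num at h
    have hx : (1+s^2)*x-(2+4*s^2) ≠ 0 := by
      intro h2
      have : x = 0 := by linarith
      subst this
      nlinarith [sq_nonneg s]
    positivity
  · have h1 : 0 < ((2+4*s^2) - s^2*x)^2 := by positivity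
    have h2 : 0 ≤ 2*s^2*((1+s^2)*x-(2+4*s^2))^2 := by positivity
    linarith

lemma phiX_den_pos (s t : ℝ) : 0 < 1+s^2*(1+Real.cos t) := by
  have : 0 ≤ s^2*(1+Real.cos t) :=
    mul_nonneg (sq_nonneg s) (by linarith [Real.neg_one_le_cos t])
  linarith

lemma hasDerivAt_mapX (s x : ℝ) : HasDerivAt (mapX s) (derX s x) x := by
  have hN : HasDerivAt (fun x : ℝ => (1+s^2)*x-(2+4*s^2)) (1+s^2) x := by
    simpa using ((hasDerivAt_id x).const_mul (1+s^2)).sub_const (2+4*s^2)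
  have hA : HasDerivAt (fun x : ℝ => (2+4*s^2) - s^2*x) (-s^2) x := by
    simpa using ((hasDerivAt_id x).const_mul (s^2)).const_sub (2+4*s^2)
  have hD := (hA.pow 2).add ((hN.pow 2).const_mul (2*s^2))
  have hM := ((hN.pow 2).const_mul (2*(2+4*s^2))).div hD (denX_pos s x).ne'
  refine hM.congr_deriv ?_
  unfold derX
  have h0 := (denX_pos s x).ne'
  simp only [Pi.add_apply, Pi.pow_apply]
  change _ / denX s x ^ 2 = _
  congr 1
  push_cast
  ring

lemma contDiff_mapX (s : ℝ) (n : WithTop ℕ∞) : ContDiff ℝ n (mapX s) := by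
  unfold mapX
  refine ContDiff.div (by fun_prop) (by unfold denX; fun_prop) (fun x => (denX_pos s x).ne')

lemma mapX_phiX (s t : ℝ) : mapX s (phiX s t) = phiX s (2*t) := by
  have h1 := phiX_den_pos s t
  have h2 := phiX_den_pos s (2*t)
  have h3 := denX_pos s (phiX s t)
  unfold mapX
  rw [div_eq_iff h3.ne']
  unfold denX phiX
  rw [Real.cos_two_mul] at *
  field_simp
  ring

lemma iter_phiX (s t : ℝ) (k : ℕ) : (mapX s)^[k] (phiX s t) = phiX s (2^k*t) := by
  induction k with
  | zero => simp
  | succ k ih => rw [Function.iterate_succ_apply', ih, mapX_phiX]; congr 1; ring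

lemma phiX_mem (s t : ℝ) : phiX s t ∈ Icc (0:ℝ) 4 := by
  have h1 := phiX_den_pos s t
  have h2 := Real.neg_one_le_cos t
  have h3 := Real.cos_le_one t
  unfold phiX
  constructor
  · exact div_nonneg (mul_nonneg (by positivity) (by linarith)) h1.le
  · rw [div_le_iff₀ h1]
    nlinarith

lemma phiX_surj (s x : ℝ) (hx : x ∈ Icc (0:ℝ) 4) : ∃ t ∈ Icc 0 Real.pi, phiX s t = x := by
  obtain ⟨h0, h4⟩ := hx
  have hA : 0 < (2+4*s^2) - s^2*x := by nlinarith [sq_nonneg s]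
  refine ⟨Real.arccos (x/((2+4*s^2) - s^2*x) - 1),
    ⟨Real.arccos_nonneg _, Real.arccos_le_pi _⟩, ?_⟩
  have h := phiX_den_pos s (Real.arccos (x/((2+4*s^2) - s^2*x) - 1))
  unfold phiX
  rw [div_eq_iff h.ne', Real.cos_arccos]
  · field_simp
    ring
  · have : 0 ≤ x/((2+4*s^2) - s^2*x) := div_nonneg h0 hA.le
    linarith
  · have : x/((2+4*s^2) - s^2*x) ≤ 2 := by
      rw [div_le_iff₀ hA]; nlinarith [sq_nonneg s]
    linarith

lemma continuous_phiX (s : ℝ) : Continuous (phiX s) := by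
  unfold phiX
  exact Continuous.div (by fun_prop) (by fun_prop) (fun t => (phiX_den_pos s t).ne')

lemma mapsTo_mapX (s : ℝ) : MapsTo (mapX s) (Icc (0:ℝ) 4) (Icc (0:ℝ) 4) := by
  intro x hx
  obtain ⟨t, -, rfl⟩ := phiX_surj s x hx
  rw [mapX_phiX]
  exact phiX_mem _ _

lemma leo_mapX (s a b : ℝ) (ha : 0 ≤ a) (hab : a < b) (hb : b ≤ 4) :
    ∃ k : ℕ, (mapX s)^[k] '' Icc a b = Icc (0:ℝ) 4 := by
  obtain ⟨t, -, ht⟩ := phiX_surj s ((a+b)/2) ⟨by linarith, by linarith⟩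
  have hopen : IsOpen (phiX s ⁻¹' Ioo a b) := isOpen_Ioo.preimage (continuous_phiX s)
  have hmem : t ∈ phiX s ⁻¹' Ioo a b := by
    rw [mem_preimage, ht]; constructor <;> linarith
  obtain ⟨δ, hδ, hball⟩ := Metric.isOpen_iff.1 hopen t hmem
  obtain ⟨k, hk⟩ := pow_unbounded_of_one_lt (2*Real.pi/δ) (one_lt_two (α := ℝ))
  refine ⟨k, Subset.antisymm ?_ ?_⟩
  · rintro _ ⟨x, hx, rfl⟩
    exact (mapsTo_mapX s).iterate k ⟨ha.trans hx.1, hx.2.trans hb⟩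
  · intro y hy
    obtain ⟨u, -, rfl⟩ := phiX_surj s y hy
    have h2k : (0:ℝ) < 2^k := by positivity
    -- representative of `u` modulo `2π` in `[2^k t, 2^k t + 2π)`
    obtain ⟨v, hv, hvu⟩ : ∃ v ∈ Ico (2^k*t) (2^k*t + 2*Real.pi), Real.cos u = Real.cos v :=
      Real.cos_periodic.exists_mem_Ico Real.two_pi_pos u (2^k*t)
    refine ⟨phiX s (v/2^k), ?_, ?_⟩
    · have : v/2^k ∈ Metric.ball t δ := by
        rw [Metric.mem_ball, Real.dist_eq, abs_lt]
        rw [div_lt_iff₀ hδ] at hk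
        have e1 : t ≤ v/2^k := by rw [le_div_iff₀ h2k]; linarith [hv.1]
        have e2 : v/2^k < t + δ := by rw [div_lt_iff₀ h2k]; linarith [hv.2]
        constructor <;> linarith
      exact Ioo_subset_Icc_self (hball this)
    · rw [iter_phiX, mul_div_cancel₀ _ h2k.ne']
      unfold phiX
      rw [hvu]

lemma continuous_derX : Continuous (fun q : ℝ × ℝ => |derX q.1 q.2|) := by
  unfold derX
  refine (Continuous.div (by fun_prop) (by unfold denX; fun_prop) ?_).abs
  intro q
  exact pow_ne_zero 2 (denX_pos q.1 q.2).ne'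

/-- The supremum of the absolute derivative. -/
noncomputable def supX (s : ℝ) : ℝ := sSup ((fun x => |derX s x|) '' Icc (0:ℝ) 4)

lemma continuous_supX : Continuous supX :=
  isCompact_Icc.continuous_sSup (f := fun s x => |derX s x|) continuous_derX

lemma supX_zero : supX 0 ≤ 4 := by
  refine csSup_le ((nonempty_Icc.2 (by norm_num)).image _) ?_
  rintro _ ⟨x, ⟨h0, h4⟩, rfl⟩
  have : derX 0 x = 2*(x-2) := by unfold derX denX; norm_num; ring
  simp only [this]
  rw [abs_le]; constructor <;> linarith

lemma le_supX (L : ℝ) (hL : 14 ≤ L) : L ≤ supX L := by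
  have hc : ContinuousOn (fun x => |derX L x|) (Icc (0:ℝ) 4) :=
    (continuous_derX.comp (Continuous.prodMk_right L)).continuousOn
  have hB : BddAbove ((fun x => |derX L x|) '' Icc (0:ℝ) 4) :=
    (isCompact_Icc.image_of_continuousOn hc).bddAbove
  have hq : 0 < 1 + L^2 + L := by positivity
  have hx : (2+4*L^2)*(1+1/L)/(1+L^2+L) ∈ Icc (0:ℝ) 4 := by
    have hL0 : 0 < L := by linarith
    constructor
    · positivity
    · rw [div_le_iff₀ hq]
      have : 1/L ≤ 1 := by rw [div_le_one hL0]; linarith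
      have e : L^2*(1/L) = L := by field_simp
      nlinarith
  refine le_trans ?_ (le_csSup hB ⟨_, hx, rfl⟩)
  refine le_trans ?_ (le_abs_self _)
  have hL0 : 0 < L := by linarith
  have hc0 : 0 < 2+4*L^2 := by positivity
  have eA : (2+4*L^2) - L^2*((2+4*L^2)*(1+1/L)/(1+L^2+L)) = (2+4*L^2)/(1+L^2+L) := by
    field_simp; ring
  have eN : (1+L^2)*((2+4*L^2)*(1+1/L)/(1+L^2+L)) - (2+4*L^2)
      = (2+4*L^2)/(1+L^2+L)/L := by
    field_simp; ring
  have e : derX L ((2+4*L^2)*(1+1/L)/(1+L^2+L)) = 4*(1+L^2+L)^2/(9*L) := by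
    unfold derX denX
    rw [eA, eN]
    generalize 2+4*L^2 = c at *
    generalize 1+L^2+L = q at *
    field_simp
    norm_num
  rw [e, le_div_iff₀ (by positivity)]
  nlinarith [mul_pos hL0 hL0, mul_pos (mul_pos hL0 hL0) hL0, sq_nonneg (L^2), mul_pos (mul_pos hL0 hL0) (mul_pos hL0 hL0)]

/-- For every integer `r ≥ 1` and every real `λ ≥ 14`, there is a `C^r` map of `[0,4]`
into itself with `sup |f'| = λ^r` such that every nondegenerate closed subinterval of
`[0,4]` is eventually mapped onto the whole interval `[0,4]` by some iterate. -/
theorem stmt_2 (r : ℕ) (hr : 1 ≤ r) (lam : ℝ) (hlam : 14 ≤ lam) :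
    ∃ f : ℝ → ℝ,
      MapsTo f (Icc (0:ℝ) 4) (Icc (0:ℝ) 4) ∧
      ContDiffOn ℝ r f (Icc (0:ℝ) 4) ∧
      sSup ((fun x => |derivWithin f (Icc (0:ℝ) 4) x|) '' Icc (0:ℝ) 4) = lam ^ r ∧
      ∀ a b : ℝ, 0 ≤ a → a < b → b ≤ 4 →
        ∃ k : ℕ, f^[k] '' Icc a b = Icc (0:ℝ) 4 := by
  have hL : 14 ≤ lam ^ r := hlam.trans (le_self_pow₀ (by linarith) (by omega))
  obtain ⟨s, -, hs⟩ : lam ^ r ∈ supX '' Icc 0 (lam ^ r) :=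
    intermediate_value_Icc (by linarith) continuous_supX.continuousOn
      ⟨supX_zero.trans (by linarith), le_supX _ hL⟩
  refine ⟨mapX s, mapsTo_mapX s, (contDiff_mapX s _).contDiffOn, ?_, leo_mapX s⟩
  rw [← hs]
  unfold supX
  congr 1
  refine image_congr fun x hx => ?_
  rw [(hasDerivAt_mapX s x).hasDerivWithinAt.derivWithin
    (uniqueDiffOn_Icc (by norm_num) x hx)]
end

section
/- Let I be a compact interval, f : I → I a continuous map, p ≥ 1 an integer, and z₀ < z₁ two points of I such that f^p(z₀) = z₀. Assume f^p is differentiable on [z₀, z₁] with (f^p)'(x) ≥ μ for all x ∈ [z₀, z₁], where μ > 1. Then for every x ∈ I with x > z₀ there exists an integer n ≥ 0 such that f^n([z₀, x]) ⊇ [z₀, z₁]. -/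
open Set

/-- If `z₀` is a fixed point of `f^p` and `f^p` has derivative `≥ μ > 1` on `[z₀,z₁]`,
then for every `x ∈ I` with `x > z₀` some iterate of `f` maps `[z₀,x]` onto a set
containing `[z₀,z₁]`. -/
theorem stmt_3 (a b : ℝ) (hab : a ≤ b) (f : ℝ → ℝ)
    (hcont : ContinuousOn f (Icc a b)) (hmaps : MapsTo f (Icc a b) (Icc a b))
    (p : ℕ) (hp : 1 ≤ p) (z₀ z₁ : ℝ)
    (hz₀ : z₀ ∈ Icc a b) (hz₁ : z₁ ∈ Icc a b) (hz₀₁ : z₀ < z₁)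
    (hfix : f^[p] z₀ = z₀) (μ : ℝ) (hμ : 1 < μ)
    (hderiv : ∀ x ∈ Icc z₀ z₁,
      ∃ d : ℝ, HasDerivWithinAt (f^[p]) d (Icc z₀ z₁) x ∧ μ ≤ d) :
    ∀ x ∈ Icc a b, z₀ < x → ∃ n : ℕ, Icc z₀ z₁ ⊆ f^[n] '' Icc z₀ x := by
  intro x hx hzx
  have hc : ContinuousOn (f^[p]) (Icc z₀ z₁) := fun y hy => by
    obtain ⟨d, hd, -⟩ := hderiv y hy
    exact hd.continuousWithinAt
  have hda : ∀ y ∈ interior (Icc z₀ z₁), ∃ d : ℝ, HasDerivAt (f^[p]) d y ∧ μ ≤ d := by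
    intro y hy
    obtain ⟨d, hd, hle⟩ := hderiv y (interior_subset hy)
    exact ⟨d, hd.hasDerivAt (mem_interior_iff_mem_nhds.mp hy), hle⟩
  have hexp : ∀ w ∈ Icc z₀ z₁, μ * (w - z₀) ≤ f^[p] w - z₀ := by
    intro w hw
    have h := (convex_Icc z₀ z₁).mul_sub_le_image_sub_of_le_deriv hc
      (fun y hy => by
        obtain ⟨d, hd, -⟩ := hda y hy
        exact hd.differentiableAt.differentiableWithinAt)
      (C := μ) (fun y hy => by
        obtain ⟨d, hd, hle⟩ := hda y hy
        rw [hd.deriv]; exact hle)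
      z₀ (left_mem_Icc.mpr hz₀₁.le) w hw hw.1
    rwa [hfix] at h
  have key : ∀ k : ℕ, Icc z₀ (min z₁ (z₀ + μ ^ k * (x - z₀))) ⊆ f^[p * k] '' Icc z₀ x := by
    intro k
    induction k with
    | zero =>
      intro y hy
      have h2 := hy.2.trans (min_le_right _ _)
      exact ⟨y, ⟨hy.1, by linarith⟩, by simp⟩
    | succ k ih =>
      have hpos : 0 < μ ^ k * (x - z₀) := mul_pos (by positivity) (by linarith)
      set w := min z₁ (z₀ + μ ^ k * (x - z₀)) with hw
      have hw0 : z₀ ≤ w := le_min hz₀₁.le (by linarith)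
      have hw1 : w ≤ z₁ := min_le_left _ _
      have hivt := intermediate_value_Icc hw0 (hc.mono (Icc_subset_Icc_right hw1))
      rw [hfix] at hivt
      have hgw := hexp w ⟨hw0, hw1⟩
      intro y hy
      have hy1 := hy.2.trans (min_le_left _ _)
      have hy2 := hy.2.trans (min_le_right _ _)
      have hyw : y ≤ f^[p] w := by
        rcases min_choice z₁ (z₀ + μ ^ k * (x - z₀)) with h | h
        · rw [← hw] at h
          nlinarith
        · rw [← hw] at h
          have : μ * (w - z₀) = μ ^ (k + 1) * (x - z₀) := by rw [h]; ring
          linarith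
      obtain ⟨v, hv, rfl⟩ := hivt ⟨hy.1, hyw⟩
      obtain ⟨u, hu, rfl⟩ := ih hv
      refine ⟨u, hu, ?_⟩
      rw [Nat.mul_succ, Nat.add_comm, Function.iterate_add_apply]
  obtain ⟨k, hk⟩ := pow_unbounded_of_one_lt ((z₁ - z₀) / (x - z₀)) hμ
  rw [div_lt_iff₀ (by linarith)] at hk
  refine ⟨p * k, ?_⟩
  have h := key k
  rwa [min_eq_left (by linarith)] at h
end

section
/- Let I be a compact interval and f : I → I a C^1 map. Let z₀ ∈ I, k ≥ 0 an integer, and suppose z₁ = f^k(z₀) is a periodic point of f of period p ≥ 1 (f^p(z₁) = z₁). Let δ > 0 with [z₀ − δ, z₀ + δ] ⊆ I, C ≠ 0 a real number and α a positive even integer such that f^k(x) = z₁ + C(x − z₀)^α for all x with |x − z₀| ≤ δ. Let z₂ = f^k(z₀ + δ) (= f^k(z₀ − δ)). Suppose that f^p is affine of slope μ > 1 on the interval with endpoints z₁ and z₂, i.e. f^p(x) = z₁ + μ(x − z₁) there, and let μ₀ be a real number with α|z₂ − z₁|/δ ≥ μ₀. Then for every nondegenerate interval J ⊆ [z₀ −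 δ, z₀ + δ] there exists an integer n ≥ 0 such that either |f^n(J)| ≥ μ₀ |J| (where |·| denotes the length of an interval) or z₂ belongs to the interior of f^n(J). -/
open Set

theorem aux_bern (r : ℕ) (u v δ M : ℝ) (hu : 0 < u) (huv : u < v) (huδ : u ≤ δ)
    (hM : 0 < M) (h : δ ^ (r + 1) ≤ M * u ^ (r + 1)) :
    ((r : ℝ) + 1) * δ ^ r * (v - u) ≤ M * (v ^ (r + 1) - u ^ (r + 1)) := by
  have hδ : 0 < δ := hu.trans_le huδ
  have h1 : δ ^ r ≤ M * u ^ r := by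
    have h2 : δ ^ r * u ≤ M * u ^ r * u := by
      calc δ ^ r * u ≤ δ ^ r * δ := by gcongr
        _ = δ ^ (r + 1) := by ring
        _ ≤ M * u ^ (r + 1) := h
        _ = M * u ^ r * u := by ring
    exact le_of_mul_le_mul_right h2 hu
  have h3 : ((r : ℝ) + 1) * u ^ r * (v - u) ≤ v ^ (r + 1) - u ^ (r + 1) := by
    have hb := one_add_mul_le_pow (a := v / u - 1) (by
      have : 0 < v / u := div_pos (hu.trans huv) hu
      linarith) (r + 1)
    have he : (1 + (v / u - 1)) ^ (r + 1) = v ^ (r + 1) / u ^ (r + 1) := by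
      rw [← div_pow]; congr 1; ring
    rw [he, le_div_iff₀ (by positivity)] at hb
    have : (1 + ((r + 1 : ℕ) : ℝ) * (v / u - 1)) * u ^ (r + 1)
        = u ^ (r + 1) + ((r : ℝ) + 1) * u ^ r * (v - u) := by
      push_cast
      field_simp
      ring
    linarith
  calc ((r : ℝ) + 1) * δ ^ r * (v - u) ≤ ((r : ℝ) + 1) * (M * u ^ r) * (v - u) := by
        have : 0 < v - u := by linarith
        gcongr
    _ = M * (((r : ℝ) + 1) * u ^ r * (v - u)) := by ring
    _ ≤ _ := by gcongr

/-- Lemma about intervals near a suitable extremum: any nondegenerate interval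
`J ⊆ [z₀-δ, z₀+δ]` is either eventually expanded by the factor `μ₀`, or some iterate
of its image contains `z₂` in its interior. -/
theorem stmt_4 (a b : ℝ) (hab : a ≤ b) (f : ℝ → ℝ)
    (hf : ContDiffOn ℝ 1 f (Icc a b)) (hmaps : MapsTo f (Icc a b) (Icc a b))
    (z₀ : ℝ) (k : ℕ) (z₁ : ℝ) (hz₁ : z₁ = f^[k] z₀)
    (p : ℕ) (hp : 1 ≤ p) (hper : f^[p] z₁ = z₁)
    (δ : ℝ) (hδ : 0 < δ) (hsub : Icc (z₀ - δ) (z₀ + δ) ⊆ Icc a b)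
    (C : ℝ) (hC : C ≠ 0) (α : ℕ) (hα : 0 < α) (hαeven : Even α)
    (hpow : ∀ x : ℝ, |x - z₀| ≤ δ → f^[k] x = z₁ + C * (x - z₀) ^ α)
    (z₂ : ℝ) (hz₂ : z₂ = f^[k] (z₀ + δ))
    (μ : ℝ) (hμ : 1 < μ)
    (haff : ∀ x ∈ uIcc z₁ z₂, f^[p] x = z₁ + μ * (x - z₁))
    (μ₀ : ℝ) (hμ₀ : μ₀ ≤ (α : ℝ) * |z₂ - z₁| / δ) :
    ∀ c d : ℝ, z₀ - δ ≤ c → c < d → d ≤ z₀ + δ →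
      ∃ n : ℕ, μ₀ * (d - c) ≤ Metric.diam (f^[n] '' Icc c d) ∨
        z₂ ∈ interior (f^[n] '' Icc c d) := by
  intro c d hc hcd hd
  have hδα : 0 < δ ^ α := by positivity
  have hz2 : z₂ = z₁ + C * δ ^ α := by
    rw [hz₂, hpow _ (by simp [abs_of_pos hδ])]; simp
  have hnn : ∀ x : ℝ, 0 ≤ (x - z₀) ^ α := fun x => hαeven.pow_nonneg _
  -- the point of maximal distance from z₀
  obtain ⟨t, htJ, htmax⟩ : ∃ t ∈ Icc c d, ∀ x ∈ Icc c d, (x - z₀) ^ α ≤ (t - z₀) ^ α := by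
    obtain ⟨t, ht, h⟩ := isCompact_Icc.exists_isMaxOn (f := fun x : ℝ => (x - z₀) ^ α)
      (nonempty_Icc.2 hcd.le) (by fun_prop)
    exact ⟨t, ht, fun x hx => h hx⟩
  have habs : ∀ x ∈ Icc c d, |x - z₀| ≤ δ := by
    intro x hx
    rw [abs_le]
    constructor <;> linarith [hx.1, hx.2]
  have hle : ∀ x ∈ Icc c d, (x - z₀) ^ α ≤ δ ^ α := by
    intro x hx
    rw [← hαeven.pow_abs]
    exact pow_le_pow_left₀ (abs_nonneg _) (habs x hx) _
  have htpos : 0 < (t - z₀) ^ α := by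
    by_contra hcon
    have h0 : ∀ x ∈ Icc c d, x - z₀ = 0 := fun x hx =>
      pow_eq_zero_iff hα.ne' |>.1 (le_antisymm ((htmax x hx).trans (not_lt.1 hcon)) (hnn x))
    have e1 := h0 c (left_mem_Icc.2 hcd.le)
    have e2 := h0 d (right_mem_Icc.2 hcd.le)
    linarith
  have hex : ∃ j : ℕ, δ ^ α < μ ^ j * (t - z₀) ^ α := by
    obtain ⟨j, hj⟩ := pow_unbounded_of_one_lt (δ ^ α / (t - z₀) ^ α) hμ
    exact ⟨j, (div_lt_iff₀ htpos).1 hj⟩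
  classical
  obtain ⟨N, hN, hNmin⟩ : ∃ N : ℕ, δ ^ α < μ ^ N * (t - z₀) ^ α ∧
      ∀ j < N, μ ^ j * (t - z₀) ^ α ≤ δ ^ α :=
    ⟨Nat.find hex, Nat.find_spec hex, fun j hj => not_lt.1 (Nat.find_min hex hj)⟩
  have hμ0 : 0 < μ := by linarith
  have hit : ∀ j ≤ N, ∀ x ∈ Icc c d,
      f^[p * j + k] x = z₁ + C * (μ ^ j * (x - z₀) ^ α) := by
    intro j
    induction j with
    | zero => intro _ x hx; simpa using hpow x (habs x hx)
    | succ j ih =>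
      intro hj x hx
      have e : p * (j + 1) + k = p + (p * j + k) := by ring
      rw [e, Function.iterate_add_apply, ih (by omega) x hx, haff]
      · ring
      · have h1 : μ ^ j * (x - z₀) ^ α ≤ δ ^ α :=
          (mul_le_mul_of_nonneg_left (htmax x hx) (by positivity)).trans (hNmin j (by omega))
        have h0 : 0 ≤ μ ^ j * (x - z₀) ^ α := mul_nonneg (by positivity) (hnn x)
        rw [hz2, mem_uIcc]
        rcases lt_or_gt_of_ne hC with hC' | hC'
        · right; constructor <;> nlinarith
        · left; constructor <;> nlinarith
  have himg : f^[p * N + k] '' Icc c d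
      = (fun x => z₁ + C * (μ ^ N * (x - z₀) ^ α)) '' Icc c d :=
    image_congr (hit N le_rfl)
  have hcont : Continuous (fun x => z₁ + C * (μ ^ N * (x - z₀) ^ α)) := by fun_prop
  refine ⟨p * N + k, ?_⟩
  rw [himg]
  by_cases hs : ∃ s ∈ Icc c d, μ ^ N * (s - z₀) ^ α < δ ^ α
  · right
    obtain ⟨s, hsJ, hs⟩ := hs
    have hoc : OrdConnected ((fun x => z₁ + C * (μ ^ N * (x - z₀) ^ α)) '' Icc c d) :=
      (isPreconnected_Icc.image _ hcont.continuousOn).ordConnected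
    have ms := mem_image_of_mem (fun x => z₁ + C * (μ ^ N * (x - z₀) ^ α)) hsJ
    have mt := mem_image_of_mem (fun x => z₁ + C * (μ ^ N * (x - z₀) ^ α)) htJ
    rcases lt_or_gt_of_ne hC with hC' | hC'
    · refine interior_maximal (Ioo_subset_Icc_self.trans (hoc.out mt ms)) isOpen_Ioo ?_
      rw [hz2]
      constructor
      · have := mul_lt_mul_of_neg_left hN hC'
        simpa using this
      · have := mul_lt_mul_of_neg_left hs hC'
        simpa using this
    · refine interior_maximal (Ioo_subset_Icc_self.trans (hoc.out ms mt)) isOpen_Ioo ?_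
      rw [hz2]
      constructor
      · have := mul_lt_mul_of_pos_left hs hC'
        simpa using this
      · have := mul_lt_mul_of_pos_left hN hC'
        simpa using this
  · left
    push Not at hs
    have hcJ : c ∈ Icc c d := left_mem_Icc.2 hcd.le
    have hdJ : d ∈ Icc c d := right_mem_Icc.2 hcd.le
    have hz0 : z₀ ∉ Icc c d := by
      intro h
      have := hs z₀ h
      simp [hα.ne'] at this
      linarith
    have hM : 0 < μ ^ N := by positivity
    obtain ⟨r, rfl⟩ : ∃ r, α = r + 1 := ⟨α - 1, by omega⟩
    have key : ((r : ℝ) + 1) * δ ^ r * (d - c) ≤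
        μ ^ N * |(c - z₀) ^ (r + 1) - (d - z₀) ^ (r + 1)| := by
      rcases lt_or_ge z₀ c with h | h
      · have := aux_bern r (c - z₀) (d - z₀) δ (μ ^ N) (by linarith) (by linarith)
          (by linarith) hM (hs c hcJ)
        rw [abs_sub_comm]
        refine le_trans ?_ (mul_le_mul_of_nonneg_left (le_abs_self _) hM.le)
        refine le_trans (le_of_eq ?_) this
        ring
      · have hd' : d < z₀ := by
          by_contra hcon
          exact hz0 ⟨h, not_lt.1 hcon⟩
        have ed : (z₀ - d) ^ (r + 1) = (d - z₀) ^ (r + 1) := by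
          rw [← hαeven.neg_pow, neg_sub]
        have ec : (z₀ - c) ^ (r + 1) = (c - z₀) ^ (r + 1) := by
          rw [← hαeven.neg_pow, neg_sub]
        have := aux_bern r (z₀ - d) (z₀ - c) δ (μ ^ N) (by linarith) (by linarith)
          (by linarith) hM (by rw [ed]; exact hs d hdJ)
        rw [ed, ec] at this
        refine le_trans ?_ (mul_le_mul_of_nonneg_left (le_abs_self _) hM.le)
        refine le_trans (le_of_eq ?_) this
        ring
    have hdist := Metric.dist_le_diam_of_mem
      (isCompact_Icc.image hcont : IsCompact (_ '' Icc c d)).isBounded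
      (mem_image_of_mem _ hcJ) (mem_image_of_mem _ hdJ)
    refine le_trans ?_ hdist
    have e1 : dist (z₁ + C * (μ ^ N * (c - z₀) ^ (r + 1))) (z₁ + C * (μ ^ N * (d - z₀) ^ (r + 1)))
        = |C| * (μ ^ N * |(c - z₀) ^ (r + 1) - (d - z₀) ^ (r + 1)|) := by
      rw [Real.dist_eq, ← abs_of_pos hM, ← abs_mul, ← abs_mul, abs_of_pos hM]
      congr 1
      ring
    have e2 : ((r + 1 : ℕ) : ℝ) * |z₂ - z₁| / δ = |C| * (((r : ℝ) + 1) * δ ^ r) := by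
      rw [hz2, add_sub_cancel_left, abs_mul, abs_of_pos hδα]
      push_cast
      field_simp
      ring
    rw [e2] at hμ₀
    calc μ₀ * (d - c) ≤ |C| * (((r : ℝ) + 1) * δ ^ r) * (d - c) :=
          mul_le_mul_of_nonneg_right hμ₀ (by linarith)
      _ = |C| * (((r : ℝ) + 1) * δ ^ r * (d - c)) := by ring
      _ ≤ |C| * (μ ^ N * |(c - z₀) ^ (r + 1) - (d - z₀) ^ (r + 1)|) :=
          mul_le_mul_of_nonneg_left key (abs_nonneg _)
      _ = _ := e1.symm
end

section
/- Let a < b be real numbers and f : [a,b] → [a,b] a continuous map. Suppose that for every nondegenerate closed subinterval J ⊆ [a,b] there exists an integer n ≥ 0 with f^n(J) = [a,b]. Then f is topologically mixing: for all nonempty open sets U, V ⊆ [a,b] there exists N ≥ 0 such that f^{-n}(U) ∩ V ≠ ∅ for all n ≥ N. -/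
open Set

/-- If every nondegenerate closed subinterval of `[a,b]` is mapped onto `[a,b]` by some
iterate of `f`, then `f` is topologically mixing on `[a,b]` (openness being relative to
the subspace topology). -/
theorem stmt_9 (a b : ℝ) (hab : a < b) (f : ℝ → ℝ)
    (hcont : ContinuousOn f (Icc a b)) (hmaps : MapsTo f (Icc a b) (Icc a b))
    (hcover : ∀ c d : ℝ, a ≤ c → c < d → d ≤ b → ∃ n : ℕ, f^[n] '' Icc c d = Icc a b) :
    ∀ U V : Set ℝ, U ⊆ Icc a b → V ⊆ Icc a b →
      (∃ U' : Set ℝ, IsOpen U' ∧ U = U' ∩ Icc a b) →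
      (∃ V' : Set ℝ, IsOpen V' ∧ V = V' ∩ Icc a b) →
      U.Nonempty → V.Nonempty →
      ∃ N : ℕ, ∀ n ≥ N, (f^[n] ⁻¹' U ∩ V).Nonempty := by
  have hsurj : f '' Icc a b = Icc a b := by
    apply Subset.antisymm hmaps.image_subset
    obtain ⟨n, hn⟩ := hcover a ((a + b) / 2) le_rfl (by linarith) (by linarith)
    cases n with
    | zero =>
      exfalso
      have hb : b ∈ Icc a b := ⟨hab.le, le_rfl⟩
      rw [← hn] at hb
      simp only [Function.iterate_zero, image_id, mem_Icc] at hb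
      linarith [hb.2]
    | succ k =>
      intro y hy
      rw [← hn] at hy
      obtain ⟨x, hx, rfl⟩ := hy
      refine ⟨f^[k] x, hmaps.iterate k ⟨hx.1, by linarith [hx.2]⟩, ?_⟩
      rw [Function.iterate_succ_apply']
  have hiter : ∀ k : ℕ, f^[k] '' Icc a b = Icc a b := by
    intro k
    induction k with
    | zero => simp
    | succ k ih => rw [Function.iterate_succ', image_comp, ih, hsurj]
  rintro U V hU hV - ⟨V', hV'o, hVe⟩ ⟨u, hu⟩ ⟨x, hx⟩
  have hJ : ∃ c d : ℝ, a ≤ c ∧ c < d ∧ d ≤ b ∧ Icc c d ⊆ V := by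
    have hx' := hx
    rw [hVe] at hx'
    obtain ⟨ε, hε, hball⟩ := Metric.isOpen_iff.1 hV'o x hx'.1
    obtain ⟨hxa, hxb⟩ := hx'.2
    have key : ∀ y, a ≤ y → y ≤ b → x - ε / 2 ≤ y → y ≤ x + ε / 2 → y ∈ V := by
      intro y h1 h2 h3 h4
      rw [hVe]
      refine ⟨hball ?_, h1, h2⟩
      rw [Metric.mem_ball, Real.dist_eq, abs_lt]
      constructor <;> linarith
    rcases hxb.lt_or_eq with h | h
    · refine ⟨x, min b (x + ε / 2), hxa, lt_min h (by linarith), min_le_left _ _, ?_⟩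
      intro y hy
      exact key y (hxa.trans hy.1) (hy.2.trans (min_le_left _ _)) (by linarith [hy.1])
        (hy.2.trans (min_le_right _ _))
    · refine ⟨max a (x - ε / 2), x, le_max_left _ _, max_lt (by linarith) (by linarith), hxb, ?_⟩
      intro y hy
      exact key y ((le_max_left _ _).trans hy.1) (hy.2.trans hxb)
        ((le_max_right _ _).trans hy.1) (by linarith [hy.2])
  obtain ⟨c, d, hc, hcd, hd, hsub⟩ := hJ
  obtain ⟨N, hN⟩ := hcover c d hc hcd hd
  refine ⟨N, fun n hn => ?_⟩
  obtain ⟨k, rfl⟩ := Nat.exists_eq_add_of_le' hn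
  have hu' := hU hu
  rw [← hiter k, ← hN, ← image_comp, ← Function.iterate_add] at hu'
  obtain ⟨z, hz, hzu⟩ := hu'
  refine ⟨z, ?_, hsub hz⟩
  rw [mem_preimage, hzu]
  exact hu
end

section
/- Let r ≥ 1 and n ≥ 1 be integers, λ ≥ 14 a real number, and f : [0,4] → [0,4] a map satisfying f(x) = λ^r x for all x ∈ [0, (5/2)λ^{-r}]. Set x_n = 1 + 1/n and y_n = x_n + 1/(2n²). (a) If f(x_n) = λ^{-nr} x_n, then x_n is a periodic point of f of exact period n+1, i.e. f^{n+1}(x_n) = x_n and f^j(x_n) ≠ x_n for 1 ≤ j ≤ n. (b) If f(y_n) = λ^{-nr} y_n, then y_n is a periodic point of f of exact period n+1. -/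
open Set

theorem aux_period (n : ℕ) (L x : ℝ) (hL : 1 < L) (hx0 : 0 < x) (hx : x ≤ 5 / 2)
    (f : ℝ → ℝ) (hlin : ∀ x ∈ Set.Icc (0:ℝ) (5 / 2 * L⁻¹), f x = L * x)
    (hf : f x = (L ^ n)⁻¹ * x) :
    f^[n + 1] x = x ∧ ∀ j : ℕ, 1 ≤ j → j ≤ n → f^[j] x ≠ x := by
  have hL0 : 0 < L := by linarith
  have key : ∀ k m : ℕ, k + m = n → f^[k + 1] x = (L ^ m)⁻¹ * x := by
    intro k
    induction k with
    | zero =>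
      intro m hm
      obtain rfl : m = n := by omega
      simpa using hf
    | succ k ih =>
      intro m hm
      rw [Function.iterate_succ_apply', ih (m + 1) (by omega), hlin]
      · field_simp
        ring
      · constructor
        · positivity
        · have h1 : (L ^ (m + 1))⁻¹ ≤ L⁻¹ := by
            apply inv_anti₀ hL0
            exact le_self_pow₀ hL.le (by omega)
          have h2 : 0 < L⁻¹ := by positivity
          calc (L ^ (m + 1))⁻¹ * x ≤ L⁻¹ * (5 / 2) := by gcongr
            _ = _ := by ring
  refine ⟨by simpa using key n 0 (by omega), ?_⟩
  intro j h1 hj h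
  obtain ⟨k, rfl⟩ : ∃ k, j = k + 1 := ⟨j - 1, by omega⟩
  rw [key k (n - k) (by omega)] at h
  have h3 : 1 < L ^ (n - k) := one_lt_pow₀ hL (by omega)
  have h4 := inv_lt_one_of_one_lt₀ h3
  nlinarith

/-- If `f : [0,4] → [0,4]` satisfies `f(x) = λ^r x` on `[0, (5/2)λ^{-r}]`, then
`x_n = 1 + 1/n` (resp. `y_n = x_n + 1/(2n²)`) is a periodic point of exact period
`n+1` as soon as `f(x_n) = λ^{-nr} x_n` (resp. `f(y_n) = λ^{-nr} y_n`). -/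
theorem stmt_11 (r n : ℕ) (hr : 1 ≤ r) (hn : 1 ≤ n) (lam : ℝ) (hlam : 14 ≤ lam)
    (f : ℝ → ℝ) (hmaps : MapsTo f (Icc (0:ℝ) 4) (Icc (0:ℝ) 4))
    (hlin : ∀ x ∈ Icc (0:ℝ) (5 / 2 * (lam ^ r)⁻¹), f x = lam ^ r * x) :
    (f (1 + 1 / (n : ℝ)) = (lam ^ (n * r))⁻¹ * (1 + 1 / (n : ℝ)) →
      f^[n + 1] (1 + 1 / (n : ℝ)) = 1 + 1 / (n : ℝ) ∧
      ∀ j : ℕ, 1 ≤ j → j ≤ n → f^[j] (1 + 1 / (n : ℝ)) ≠ 1 + 1 / (n : ℝ)) ∧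
    (f (1 + 1 / (n : ℝ) + 1 / (2 * (n : ℝ) ^ 2)) =
        (lam ^ (n * r))⁻¹ * (1 + 1 / (n : ℝ) + 1 / (2 * (n : ℝ) ^ 2)) →
      f^[n + 1] (1 + 1 / (n : ℝ) + 1 / (2 * (n : ℝ) ^ 2)) =
        1 + 1 / (n : ℝ) + 1 / (2 * (n : ℝ) ^ 2) ∧
      ∀ j : ℕ, 1 ≤ j → j ≤ n →
        f^[j] (1 + 1 / (n : ℝ) + 1 / (2 * (n : ℝ) ^ 2)) ≠
          1 + 1 / (n : ℝ) + 1 / (2 * (n : ℝ) ^ 2)) := by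
  have hL : 1 < lam ^ r := one_lt_pow₀ (by linarith) (by omega)
  have hn1 : (1:ℝ) ≤ n := by exact_mod_cast hn
  have h1 : 1 / (n:ℝ) ≤ 1 := by
    rw [div_le_one (by linarith)]; exact hn1
  have h2 : 1 / (2 * (n:ℝ) ^ 2) ≤ 1 / 2 := by
    apply one_div_le_one_div_of_le (by norm_num)
    nlinarith
  have h3 : 0 < 1 / (n:ℝ) := by positivity
  have h4 : 0 < 1 / (2 * (n:ℝ) ^ 2) := by positivity
  have e : lam ^ (n * r) = (lam ^ r) ^ n := by rw [← pow_mul, mul_comm]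
  rw [e]
  exact ⟨fun h => aux_period n _ _ hL (by linarith) (by linarith) f hlin h,
    fun h => aux_period n _ _ hL (by linarith) (by linarith) f hlin h⟩
end

section
/- Let f : [0,1] → [0,1] be a C^1 map which is topologically transitive, i.e. for all nonempty open sets U, V ⊆ [0,1] there exists an integer n ≥ 1 with f^n(U) ∩ V ≠ ∅. Then every fixed point c of f (f(c) = c) satisfies f'(c) ≠ 0. -/
open Set

/-- A `C^1` topologically transitive self-map of `[0,1]` has nonzero derivative at each
of its fixed points. -/
theorem stmt_12 (f : ℝ → ℝ) (hmaps : MapsTo f (Icc (0:ℝ) 1) (Icc (0:ℝ) 1))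
    (hf : ContDiffOn ℝ 1 f (Icc (0:ℝ) 1))
    (htrans : ∀ U V : Set ℝ, U ⊆ Icc (0:ℝ) 1 → V ⊆ Icc (0:ℝ) 1 →
      (∃ U' : Set ℝ, IsOpen U' ∧ U = U' ∩ Icc (0:ℝ) 1) →
      (∃ V' : Set ℝ, IsOpen V' ∧ V = V' ∩ Icc (0:ℝ) 1) →
      U.Nonempty → V.Nonempty →
      ∃ n : ℕ, 1 ≤ n ∧ (f^[n] '' U ∩ V).Nonempty) :
    ∀ c ∈ Icc (0:ℝ) 1, f c = c → derivWithin f (Icc (0:ℝ) 1) c ≠ 0 := by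
  intro c hc hfc h0
  have hd : HasDerivWithinAt f 0 (Icc (0:ℝ) 1) c := by
    have h := ((hf.differentiableOn (by norm_num)) c hc).hasDerivWithinAt
    rwa [h0] at h
  have ho := (hasDerivWithinAt_iff_isLittleO.1 hd).bound (show (0:ℝ) < 1 by norm_num)
  rw [Filter.Eventually, Metric.mem_nhdsWithin_iff] at ho
  obtain ⟨δ, hδ, hb⟩ := ho
  have key : ∀ x ∈ Icc (0:ℝ) 1, |x - c| < δ → |f x - c| ≤ |x - c| := by
    intro x hx hxc
    have h := hb ⟨by rwa [Metric.mem_ball, Real.dist_eq], hx⟩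
    simpa [hfc] using h
  obtain ⟨r, hr0, hrδ, hr4⟩ : ∃ r : ℝ, 0 < r ∧ r ≤ δ ∧ r ≤ 1 / 4 :=
    ⟨min δ (1 / 4), lt_min hδ (by norm_num), min_le_left _ _, min_le_right _ _⟩
  have hV : ({x | r < |x - c|} ∩ Icc (0:ℝ) 1).Nonempty := by
    rcases le_total c (1 / 2) with h | h
    · refine ⟨1, ?_, by norm_num, le_rfl⟩
      exact lt_of_lt_of_le (show r < 1 - c by linarith) (le_abs_self _)
    · refine ⟨0, ?_, le_rfl, by norm_num⟩
      exact lt_of_lt_of_le (show r < -(0 - c) by linarith) (neg_le_abs _)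
  obtain ⟨n, -, y, ⟨x, hx, rfl⟩, hy⟩ := htrans ({x | |x - c| < r} ∩ Icc (0:ℝ) 1)
    ({x | r < |x - c|} ∩ Icc (0:ℝ) 1) inter_subset_right inter_subset_right
    ⟨_, isOpen_lt (by fun_prop) (by fun_prop), rfl⟩
    ⟨_, isOpen_lt (by fun_prop) (by fun_prop), rfl⟩
    ⟨c, by simpa using hr0, hc⟩ hV
  have hinv : MapsTo f ({x | |x - c| < r} ∩ Icc (0:ℝ) 1) ({x | |x - c| < r} ∩ Icc (0:ℝ) 1) :=
    fun z hz => ⟨lt_of_le_of_lt (key z hz.2 (lt_of_lt_of_le hz.1 hrδ)) hz.1, hmaps hz.2⟩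
  have h1 : |f^[n] x - c| < r := (hinv.iterate n hx).1
  have h2 : r < |f^[n] x - c| := hy.1
  exact lt_asymm h1 h2
end

section
/- Let r ≥ 1 be an integer, λ ≥ 14 a real number, and f : [0,4] → [0,4] a continuous map such that f(x) = λ^r x for all x ∈ [0, (5/2)λ^{-r}] and f(1/2) = 4. Then for every nondegenerate interval J ⊆ [0,4] with 0 ∈ J, there exists an integer k ≥ 0 such that f^k(J) = [0,4]. -/
open Set

/-- If `f : [0,4] → [0,4]` is continuous with `f(x) = λ^r x` on `[0, (5/2)λ^{-r}]` and
`f(1/2) = 4`, then every nondegenerate subinterval of `[0,4]` containing `0` is mapped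
onto `[0,4]` by some iterate of `f`. -/
theorem stmt_13 (r : ℕ) (hr : 1 ≤ r) (lam : ℝ) (hlam : 14 ≤ lam)
    (f : ℝ → ℝ) (hcont : ContinuousOn f (Icc (0:ℝ) 4))
    (hmaps : MapsTo f (Icc (0:ℝ) 4) (Icc (0:ℝ) 4))
    (hlin : ∀ x ∈ Icc (0:ℝ) (5 / 2 * (lam ^ r)⁻¹), f x = lam ^ r * x)
    (hhalf : f (1 / 2) = 4) :
    ∀ J : Set ℝ, J ⊆ Icc (0:ℝ) 4 → J.OrdConnected → (0:ℝ) ∈ J → (∃ x ∈ J, x ≠ 0) →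
      ∃ k : ℕ, f^[k] '' J = Icc (0:ℝ) 4 := by
  intro J hJ hconn h0 ⟨x, hx, hx0⟩
  have hL : 14 ≤ lam ^ r := hlam.trans (le_self_pow₀ (by linarith) (by omega))
  generalize lam ^ r = L at *
  have hLpos : 0 < L := by linarith
  have hcpos : 0 < 5 / 2 * L⁻¹ := by positivity
  have hcL : L * (5 / 2 * L⁻¹) = 5 / 2 := by field_simp
  generalize 5 / 2 * L⁻¹ = c at *
  have hc4 : c ≤ 4 := by nlinarith
  have f0 : f 0 = 0 := by rw [hlin 0 ⟨le_rfl, hcpos.le⟩, mul_zero]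
  have ivt : ∀ b, 0 ≤ b → b ≤ 4 → Icc 0 (f b) ⊆ f '' Icc 0 b := by
    intro b hb hb4
    have := intermediate_value_Icc hb (hcont.mono (Icc_subset_Icc_right hb4))
    rwa [f0] at this
  have base : ∀ e, c ≤ e → Icc 0 4 ⊆ f^[2] '' Icc 0 e := by
    intro e he
    have h1 : Icc 0 (5/2) ⊆ f '' Icc 0 c := by
      have := ivt c hcpos.le hc4
      rwa [hlin c ⟨hcpos.le, le_rfl⟩, hcL] at this
    have h2 : Icc 0 4 ⊆ f '' Icc 0 (1/2) := by
      have := ivt (1/2) (by norm_num) (by norm_num)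
      rwa [hhalf] at this
    intro y hy
    obtain ⟨z, hz, rfl⟩ := h2 hy
    obtain ⟨w, hw, rfl⟩ := h1 ⟨hz.1, hz.2.trans (by norm_num)⟩
    exact ⟨w, ⟨hw.1, hw.2.trans he⟩, rfl⟩
  have key : ∀ n : ℕ, ∀ e, 0 < e → c ≤ L ^ n * e → ∃ k, Icc 0 4 ⊆ f^[k] '' Icc 0 e := by
    intro n
    induction n with
    | zero => intro e _ h; exact ⟨2, base e (by simpa using h)⟩
    | succ n ih =>
      intro e he h
      rcases le_or_gt c e with hce | hce
      · exact ⟨2, base e hce⟩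
      obtain ⟨k, hk⟩ := ih (L * e) (by positivity) (by rw [pow_succ] at h; linarith)
      have h1 := ivt e he.le (by linarith)
      rw [hlin e ⟨he.le, hce.le⟩] at h1
      refine ⟨k + 1, ?_⟩
      rw [Function.iterate_succ, image_comp]
      exact hk.trans (image_mono h1)
  have hxpos : 0 < x := lt_of_le_of_ne (hJ hx).1 (Ne.symm hx0)
  obtain ⟨n, hn⟩ := pow_unbounded_of_one_lt (c / x) (by linarith : (1:ℝ) < L)
  obtain ⟨k, hk⟩ := key n x hxpos ((div_le_iff₀ hxpos).1 hn.le)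
  refine ⟨k, Subset.antisymm ?_ (hk.trans (image_mono (hconn.out h0 hx)))⟩
  rintro _ ⟨y, hy, rfl⟩
  exact hmaps.iterate k (hJ hy)
end

section
/- For every integer r ≥ 1 and every real number λ ≥ 14, there exists a C^r self-map of the circle ℝ/4ℤ which is topologically mixing and whose derivative has supremum norm equal to λ^r. -/
open Set

/-- For every integer `r ≥ 1` and real `λ ≥ 14`, there is a `C^r` self-map of the circle
`ℝ/4ℤ` (given by a `C^r` lift `F : ℝ → ℝ` with `F(x+4) = F(x) + 4d` for some degree
`d ∈ ℤ`) which is topologically mixing and whose derivative has supremum norm `λ^r`. -/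
theorem stmt_18 (r : ℕ) (hr : 1 ≤ r) (lam : ℝ) (hlam : 14 ≤ lam) :
    ∃ g : AddCircle (4 : ℝ) → AddCircle (4 : ℝ), ∃ F : ℝ → ℝ, ∃ d : ℤ,
      ContDiff ℝ r F ∧
      (∀ x : ℝ, F (x + 4) = F x + 4 * d) ∧
      (∀ x : ℝ, g (x : AddCircle (4 : ℝ)) = (F x : AddCircle (4 : ℝ))) ∧
      (∀ U V : Set (AddCircle (4 : ℝ)), IsOpen U → IsOpen V →
        U.Nonempty → V.Nonempty →
        ∃ N : ℕ, ∀ n ≥ N, (g^[n] ⁻¹' U ∩ V).Nonempty) ∧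
      sSup ((fun x => |deriv F x|) '' Icc (0 : ℝ) 4) = lam ^ r := by
  have hL : (14 : ℝ) ≤ lam ^ r :=
    hlam.trans (le_self_pow₀ (by linarith) (by omega))
  obtain ⟨d, a, hd, ha0, ha1, hda⟩ :
      ∃ (d : ℤ) (a : ℝ), (14 : ℝ) ≤ d ∧ 0 ≤ a ∧ a < 1 ∧ d + a = lam ^ r := by
    refine ⟨⌊lam ^ r⌋, Int.fract (lam ^ r), ?_, Int.fract_nonneg _, Int.fract_lt_one _,
      Int.floor_add_fract _⟩
    have : (14 : ℤ) ≤ ⌊lam ^ r⌋ := Int.le_floor.2 (by exact_mod_cast hL)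
    exact_mod_cast this
  set F : ℝ → ℝ := fun x => d * x + a * (2 / Real.pi) * Real.sin (Real.pi / 2 * x) with hF
  have hpi := Real.pi_pos
  have hderiv : ∀ x, HasDerivAt F (d + a * Real.cos (Real.pi / 2 * x)) x := by
    intro x
    have h1 : HasDerivAt (fun x : ℝ => Real.pi / 2 * x) (Real.pi / 2) x := by
      simpa using (hasDerivAt_id x).const_mul (Real.pi / 2)
    have h2 : HasDerivAt (fun x : ℝ => (d : ℝ) * x) d x := by
      simpa using (hasDerivAt_id x).const_mul (d : ℝ)
    have h3 := h2.add (h1.sin.const_mul (a * (2 / Real.pi)))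
    have h4 : (d : ℝ) + a * (2 / Real.pi) * (Real.cos (Real.pi / 2 * x) * (Real.pi / 2)) =
        d + a * Real.cos (Real.pi / 2 * x) := by
      field_simp
    rw [h4] at h3
    exact h3
  have hFd : deriv F = fun x => d + a * Real.cos (Real.pi / 2 * x) :=
    funext fun x => (hderiv x).deriv
  have hcont : Continuous F := by fun_prop
  have hper : ∀ x : ℝ, F (x + 4) = F x + 4 * d := by
    intro x
    have : Real.pi / 2 * (x + 4) = Real.pi / 2 * x + 2 * Real.pi := by ring
    simp only [hF, this, Real.sin_add_two_pi]
    ring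
  have hexp : ∀ u v, u ≤ v → 2 * (v - u) ≤ F v - F u := by
    intro u v huv
    refine mul_sub_le_image_sub_of_le_deriv (fun x => (hderiv x).differentiableAt) ?_ huv
    intro x
    rw [hFd]
    have := Real.neg_one_le_cos (Real.pi / 2 * x)
    simp only
    nlinarith
  have hexpn : ∀ n : ℕ, ∀ u v, u ≤ v → 2 ^ n * (v - u) ≤ F^[n] v - F^[n] u := by
    intro n
    induction n with
    | zero => intro u v _; simp
    | succ n ih =>
      intro u v huv
      have h1 := hexp u v huv
      have h2 := ih (F u) (F v) (by linarith)
      rw [Function.iterate_succ_apply, Function.iterate_succ_apply]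
      have h3 : (0 : ℝ) < 2 ^ n := by positivity
      calc (2 : ℝ) ^ (n + 1) * (v - u) = 2 ^ n * (2 * (v - u)) := by ring
        _ ≤ 2 ^ n * (F v - F u) := by gcongr
        _ ≤ _ := h2
  have hlift : Function.Periodic (fun x : ℝ => (F x : AddCircle (4 : ℝ))) 4 := by
    intro x
    simp only [hper]
    rw [AddCircle.coe_add]
    have : ((4 * d : ℝ) : AddCircle (4 : ℝ)) = 0 :=
      (AddCircle.coe_eq_zero_iff 4).2 ⟨d, by simp [mul_comm]⟩
    rw [this, add_zero]
  have hg : ∀ x : ℝ, hlift.lift (x : AddCircle (4 : ℝ)) = (F x : AddCircle (4 : ℝ)) :=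
    fun x => hlift.lift_coe x
  have hgn : ∀ n : ℕ, ∀ x : ℝ, hlift.lift^[n] (x : AddCircle (4 : ℝ)) =
      (F^[n] x : AddCircle (4 : ℝ)) := by
    intro n
    induction n with
    | zero => intro x; rfl
    | succ n ih =>
      intro x
      rw [Function.iterate_succ_apply, hg, ih, Function.iterate_succ_apply]
  refine ⟨hlift.lift, F, d, by fun_prop, hper, hg, ?_, ?_⟩
  · rintro U V - hV ⟨u, hu⟩ ⟨v, hv⟩
    obtain ⟨y, rfl⟩ := QuotientAddGroup.mk_surjective u
    obtain ⟨z, rfl⟩ := QuotientAddGroup.mk_surjective v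
    have hVo : IsOpen ((fun x : ℝ => (x : AddCircle (4 : ℝ))) ⁻¹' V) :=
      hV.preimage (AddCircle.continuous_mk' 4)
    obtain ⟨ε, hε, hball⟩ := Metric.isOpen_iff.1 hVo z hv
    obtain ⟨N, hN⟩ := pow_unbounded_of_one_lt (4 / (ε / 2)) (one_lt_two : (1 : ℝ) < 2)
    refine ⟨N, fun n hn => ?_⟩
    have hlen : 4 ≤ F^[n] (z + ε / 2) - F^[n] z := by
      have h1 := hexpn n z (z + ε / 2) (by linarith)
      have h2 : (2 : ℝ) ^ N ≤ 2 ^ n := pow_le_pow_right₀ (by norm_num) hn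
      rw [div_lt_iff₀ (by positivity)] at hN
      have h3 : (2 : ℝ) ^ N * (ε / 2) ≤ 2 ^ n * (ε / 2) := by gcongr
      have h4 : z + ε / 2 - z = ε / 2 := by ring
      rw [h4] at h1
      linarith
    set k : ℤ := ⌈(F^[n] z - y) / 4⌉
    have hk1 : (F^[n] z - y) / 4 ≤ k := Int.le_ceil _
    have hk2 : (k : ℝ) < (F^[n] z - y) / 4 + 1 := Int.ceil_lt_add_one _
    obtain ⟨w, hw, hwe⟩ := intermediate_value_Icc (by linarith : z ≤ z + ε / 2)
      (hcont.iterate n).continuousOn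
      (show y + k * 4 ∈ Icc (F^[n] z) (F^[n] (z + ε / 2)) from
        ⟨by linarith, by linarith⟩)
    refine ⟨(w : AddCircle (4 : ℝ)), ?_, ?_⟩
    · rw [mem_preimage, hgn, hwe, AddCircle.coe_add]
      have : ((k * 4 : ℝ) : AddCircle (4 : ℝ)) = 0 :=
        (AddCircle.coe_eq_zero_iff 4).2 ⟨k, by simp⟩
      rw [this, add_zero]
      exact hu
    · apply hball
      rw [Metric.mem_ball, Real.dist_eq, abs_lt]
      constructor <;> linarith [hw.1, hw.2]
  · apply IsGreatest.csSup_eq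
    rw [hFd]
    refine ⟨⟨0, by simp, ?_⟩, ?_⟩
    · simp only [mul_zero, Real.cos_zero, mul_one]
      rw [hda, abs_of_nonneg (by linarith)]
    · rintro _ ⟨x, -, rfl⟩
      have h1 := Real.neg_one_le_cos (Real.pi / 2 * x)
      have h2 := Real.cos_le_one (Real.pi / 2 * x)
      simp only
      rw [abs_le]
      constructor <;> nlinarith
end
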